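/- arXiv:1910.08882 — 9 statements merged into one kernel-verified Lean document; each statement's English description precedes it below -/
import Mathlib

section
/- Let N ≥ 1 and let V1, V2 : ℝ → ℝ be measurable potentials such that ∫_ℝ |x|^k e^{−V1(x)} dx < ∞ and ∫_ℝ |x|^k e^{−2V2(x)} dx < ∞ for every integer k ≥ 0, and such that all the multi-dimensional integrals below converge absolutely. Define the grand canonical partition function Z_N(X) = Σ_{(L,M): L+2M=2N, L,M≥0} (X^L/(L! M!)) ∫_{ℝ^L} ∫_{ℝ^M} ∏_{1≤j<k≤L} |α_k−α_j| · ∏_{1≤j<k≤M} |β_k−β_j|^4 · ∏_{j=1}^{L} ∏_{k=1}^{M} |α_j−β_k|^2 · ∏_{j=1}^{L} e^{−V1(α_j)} · ∏_{k=1}^{M} e^{−2V2(β_k)} dβ dα. Then Z_N(X) = 2^N · Pf(m_{i,j}(X))_{i,j=0}^{2N−1}, where m_{i,j}(X) = (X²/2) ∫_{ℝ×ℝ} y^i z^j sgn(z−y) e^{−V1(y)−V1(z)} dy dz + ((j−i)/2) ∫_ℝ y^{i+j−1} e^{−2V2(y)} dy. -/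
open MeasureTheory Finset

/-- The Pfaffian of a `2N × 2N` real (antisymmetric) matrix,
`Pf(A) = (1/(2^N N!)) Σ_{σ ∈ S_{2N}} sgn(σ) Π_{i=1}^{N} A_{σ(2i−1),σ(2i)}`. -/
noncomputable def pfaffian {N : ℕ} (A : Matrix (Fin (2 * N)) (Fin (2 * N)) ℝ) : ℝ :=
  (1 / (2 ^ N * (Nat.factorial N : ℝ))) *
    ∑ σ : Equiv.Perm (Fin (2 * N)),
      ((Equiv.Perm.sign σ : ℤ) : ℝ) *
        ∏ i : Fin N,
          A (σ ⟨2 * i.1, by have := i.isLt; omega⟩) (σ ⟨2 * i.1 + 1, by have := i.isLt; omega⟩)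

/-- The Boltzmann factor of the two-component log-gas with `L` charge `+1` particles at
positions `α` and `M` charge `+2` particles at positions `β`, with external potentials
`V1` and `V2` respectively. -/
noncomputable def boltzmann (V1 V2 : ℝ → ℝ) (L M : ℕ) (α : Fin L → ℝ) (β : Fin M → ℝ) : ℝ :=
  (∏ j : Fin L, ∏ k ∈ Finset.Ioi j, |α k - α j|) *
  (∏ j : Fin M, ∏ k ∈ Finset.Ioi j, |β k - β j| ^ 4) *
  (∏ j : Fin L, ∏ k : Fin M, |α j - β k| ^ 2) *
  (∏ j : Fin L, Real.exp (-V1 (α j))) *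
  (∏ k : Fin M, Real.exp (-2 * V2 (β k)))

/-- The moments `m_{i,j}(X)` appearing in the Pfaffian formula for the grand canonical
partition function. -/
noncomputable def moment (V1 V2 : ℝ → ℝ) (X : ℝ) (i j : ℕ) : ℝ :=
  X ^ 2 / 2 *
      (∫ yz : ℝ × ℝ,
        yz.1 ^ i * yz.2 ^ j * Real.sign (yz.2 - yz.1) * Real.exp (-V1 yz.1 - V1 yz.2)) +
    ((j : ℝ) - (i : ℝ)) / 2 * (∫ y : ℝ, y ^ (i + j - 1) * Real.exp (-2 * V2 y))

section Pairs

/-- The even position `2i` of the `i`-th consecutive pair. -/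
def pairFst {N : ℕ} (i : Fin N) : Fin (2 * N) := ⟨2 * i.1, by have := i.isLt; omega⟩

/-- The odd position `2i+1` of the `i`-th consecutive pair. -/
def pairSnd {N : ℕ} (i : Fin N) : Fin (2 * N) := ⟨2 * i.1 + 1, by have := i.isLt; omega⟩

/-- Positions in `Fin (2N)` are pairs of a block index and a position inside the block. -/
def pairEquiv (N : ℕ) : Fin N × Fin 2 ≃ Fin (2 * N) :=
  finProdFinEquiv.trans (finCongr (Nat.mul_comm N 2))

lemma pairEquiv_zero {N : ℕ} (i : Fin N) : pairEquiv N (i, 0) = pairFst i := by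
  ext; simp [pairEquiv, pairFst]

lemma pairEquiv_one {N : ℕ} (i : Fin N) : pairEquiv N (i, 1) = pairSnd i := by
  ext; simp [pairEquiv, pairSnd]; omega

lemma prod_pairs {R : Type*} [CommMonoid R] {N : ℕ} (f : Fin (2 * N) → R) :
    ∏ r, f r = ∏ i, f (pairFst i) * f (pairSnd i) := by
  rw [← (pairEquiv N).prod_comp, Fintype.prod_prod_type]
  simp [Fin.prod_univ_two, pairEquiv_zero, pairEquiv_one]

/-- The unnormalised Pfaffian sum of a family of matrices, one for each pair. -/
noncomputable def pfSum {N : ℕ} (c : Fin N → Fin (2 * N) → Fin (2 * N) → ℝ) : ℝ :=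
  ∑ σ : Equiv.Perm (Fin (2 * N)), ((Equiv.Perm.sign σ : ℤ) : ℝ) *
    ∏ i, c i (σ (pairFst i)) (σ (pairSnd i))

lemma pfaffian_eq_pfSum {N : ℕ} (A : Matrix (Fin (2 * N)) (Fin (2 * N)) ℝ) :
    pfaffian A = (1 / (2 ^ N * (Nat.factorial N : ℝ))) * pfSum fun _ => A := rfl

lemma pfSum_comp_perm {N : ℕ} (c : Fin N → Fin (2 * N) → Fin (2 * N) → ℝ)
    (π : Equiv.Perm (Fin N)) : pfSum (fun i => c (π i)) = pfSum c := by
  let ρ : Equiv.Perm (Fin (2 * N)) :=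
    (pairEquiv N).permCongr (Equiv.prodCongrLeft fun _ : Fin 2 => π)
  have hs : Equiv.Perm.sign ρ = 1 := by
    simp [ρ, Equiv.Perm.sign_prodCongrLeft]
  have h0 : ∀ i, ρ (pairFst i) = pairFst (π i) := by
    intro i; simp [ρ, ← pairEquiv_zero]
  have h1 : ∀ i, ρ (pairSnd i) = pairSnd (π i) := by
    intro i; simp [ρ, ← pairEquiv_one]
  unfold pfSum
  rw [← Equiv.sum_comp (Equiv.mulRight ρ)]
  refine Finset.sum_congr rfl fun σ _ => ?_
  rw [← Equiv.prod_comp π (fun i => c i (σ (pairFst i)) (σ (pairSnd i)))]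
  simp [hs, h0, h1]

lemma pfSum_eq_antisymm_at {N : ℕ} (c : Fin N → Fin (2 * N) → Fin (2 * N) → ℝ) (i : Fin N) :
    pfSum c = ∑ σ : Equiv.Perm (Fin (2 * N)), ((Equiv.Perm.sign σ : ℤ) : ℝ) *
      ((c i (σ (pairFst i)) (σ (pairSnd i)) - c i (σ (pairSnd i)) (σ (pairFst i))) / 2 *
      ∏ j ∈ Finset.univ.erase i, c j (σ (pairFst j)) (σ (pairSnd j))) := by
  have hne : (pairFst i) ≠ pairSnd i := by simp [pairFst, pairSnd]
  have key : pfSum c = - ∑ σ : Equiv.Perm (Fin (2 * N)), ((Equiv.Perm.sign σ : ℤ) : ℝ) *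
      (c i (σ (pairSnd i)) (σ (pairFst i)) *
      ∏ j ∈ Finset.univ.erase i, c j (σ (pairFst j)) (σ (pairSnd j))) := by
    unfold pfSum
    rw [← Equiv.sum_comp (Equiv.mulRight (Equiv.swap (pairFst i) (pairSnd i))), ← Finset.sum_neg_distrib]
    refine Finset.sum_congr rfl fun σ _ => ?_
    rw [← Finset.mul_prod_erase _ _ (Finset.mem_univ i)]
    have : ∀ j ∈ Finset.univ.erase i,
        c j ((σ * Equiv.swap (pairFst i) (pairSnd i)) (pairFst j))
          ((σ * Equiv.swap (pairFst i) (pairSnd i)) (pairSnd j))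
        = c j (σ (pairFst j)) (σ (pairSnd j)) := by
      intro j hj
      have hj' : (j : ℕ) ≠ i := fun h => (Finset.ne_of_mem_erase hj) (Fin.ext h)
      rw [Equiv.Perm.mul_apply, Equiv.Perm.mul_apply, Equiv.swap_apply_of_ne_of_ne,
        Equiv.swap_apply_of_ne_of_ne]
      all_goals simp only [pairFst, pairSnd, ne_eq, Fin.mk.injEq]; omega
    simp only [Equiv.coe_mulRight]
    rw [Finset.prod_congr rfl this]
    simp [Equiv.Perm.sign_swap hne]
  have key2 : pfSum c = ∑ σ : Equiv.Perm (Fin (2 * N)), ((Equiv.Perm.sign σ : ℤ) : ℝ) *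
      (c i (σ (pairFst i)) (σ (pairSnd i)) *
      ∏ j ∈ Finset.univ.erase i, c j (σ (pairFst j)) (σ (pairSnd j))) := by
    unfold pfSum
    refine Finset.sum_congr rfl fun σ _ => ?_
    rw [← Finset.mul_prod_erase _ _ (Finset.mem_univ i)]
  have : pfSum c = (pfSum c + pfSum c) / 2 := by ring
  rw [this]
  nth_rewrite 1 [key2]
  rw [key, ← sub_eq_add_neg, ← Finset.sum_sub_distrib, Finset.sum_div]
  refine Finset.sum_congr rfl fun σ _ => ?_
  ring

/-- The Pfaffian sum only depends on the antisymmetric part of the matrix. -/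
lemma pfSum_congr_antisymm {N : ℕ} (A B : Fin (2 * N) → Fin (2 * N) → ℝ)
    (h : ∀ i j, A i j - A j i = B i j - B j i) :
    pfSum (fun _ : Fin N => A) = pfSum fun _ => B := by
  have : ∀ s : Finset (Fin N), pfSum (fun i => if i ∈ s then B else A)
      = pfSum (fun _ : Fin N => A) := by
    intro s
    induction s using Finset.induction_on with
    | empty => simp
    | insert a s ha ih =>
      rw [← ih, pfSum_eq_antisymm_at _ a, pfSum_eq_antisymm_at (fun i => if i ∈ s then B else A) a]
      refine Finset.sum_congr rfl fun σ _ => ?_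
      congr 2
      · simp [ha, h]
      · refine Finset.prod_congr rfl fun j hj => ?_
        simp [Finset.ne_of_mem_erase hj]
  simpa using (this Finset.univ).symm

/-- Binomial expansion of the Pfaffian sum of a sum of two matrices. -/
lemma pfSum_add {N : ℕ} (A B : Fin (2 * N) → Fin (2 * N) → ℝ) :
    pfSum (fun _ : Fin N => fun i j => A i j + B i j) =
      ∑ P ∈ Finset.range (N + 1), (N.choose P : ℝ) *
        pfSum (fun i : Fin N => if i.1 < P then A else B) := by
  have h1 : pfSum (fun _ : Fin N => fun i j => A i j + B i j) =
      ∑ s ∈ (Finset.univ : Finset (Fin N)).powerset, pfSum (fun i => if i ∈ s then A else B) := by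
    unfold pfSum
    rw [Finset.sum_comm]
    refine Finset.sum_congr rfl fun σ _ => ?_
    rw [Finset.prod_add, Finset.mul_sum]
    refine Finset.sum_congr rfl fun s _ => ?_
    congr 1
    rw [← Finset.prod_sdiff (Finset.subset_univ s), mul_comm]
    congr 1
    · exact Finset.prod_congr rfl fun i hi => by simp [(Finset.mem_sdiff.1 hi).2]
    · exact Finset.prod_congr rfl fun i hi => by simp [hi]
  have h2 : ∀ s : Finset (Fin N), pfSum (fun i => if i ∈ s then A else B)
      = pfSum (fun i : Fin N => if i.1 < s.card then A else B) := by
    intro s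
    have hs : s.card ≤ N := by simpa using s.card_le_univ
    have hc : Fintype.card {i : Fin N // i.1 < s.card} = Fintype.card {i : Fin N // i ∈ s} := by
      rw [Fintype.card_subtype, Fintype.card_coe, Fin.card_filter_val_lt]; omega
    let e := Fintype.equivOfCardEq hc
    rw [← pfSum_comp_perm _ e.extendSubtype]
    congr 1
    ext1 i
    by_cases hi : i.1 < s.card
    · rw [if_pos hi, if_pos (e.extendSubtype_mem i hi)]
    · rw [if_neg hi, if_neg (e.extendSubtype_not_mem i hi)]
  rw [h1, Finset.sum_congr rfl fun s _ => h2 s,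
    Finset.sum_powerset_apply_card (fun P => pfSum (fun i : Fin N => if i.1 < P then A else B))]
  simp

end Pairs

section SignSum

/-- Expansion of an alternating sum over `Perm (Fin (n+1))` along the image of `0`. -/
lemma sum_sign_perm_succ {n : ℕ} (Φ : (Fin (n + 1) → Fin (n + 1)) → ℝ) :
    ∑ σ : Equiv.Perm (Fin (n + 1)), ((Equiv.Perm.sign σ : ℤ) : ℝ) * Φ σ =
      ∑ a : Fin (n + 1), (-1) ^ (a : ℕ) * ∑ e : Equiv.Perm (Fin n),
        ((Equiv.Perm.sign e : ℤ) : ℝ) * Φ (Fin.cons a fun i => a.succAbove (e i)) := by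
  rw [Finset.univ_perm_fin_succ, ← Finset.univ_product_univ]
  simp only [Finset.sum_map, Equiv.toEmbedding_apply, Finset.sum_product]
  refine Finset.sum_congr rfl fun a _ => ?_
  rw [Finset.mul_sum]
  cases a using Fin.cases with
  | zero =>
    refine Finset.sum_congr rfl fun e _ => ?_
    rw [Equiv.Perm.decomposeFin.symm_sign]
    have : (⇑(Equiv.Perm.decomposeFin.symm (0, e)) : Fin (n + 1) → Fin (n + 1))
        = Fin.cons 0 fun i => (0 : Fin (n + 1)).succAbove (e i) := by
      ext1 i
      cases i using Fin.cases <;> simp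
    rw [this]
    simp
  | succ a =>
    conv_rhs => rw [← Equiv.sum_comp (Equiv.mulLeft a.cycleRange)]
    refine Finset.sum_congr rfl fun e _ => ?_
    rw [Equiv.Perm.decomposeFin.symm_sign, if_neg (Fin.succ_ne_zero a)]
    have : (⇑(Equiv.Perm.decomposeFin.symm (a.succ, e)) : Fin (n + 1) → Fin (n + 1))
        = Fin.cons a.succ fun i => a.succ.succAbove (a.cycleRange (e i)) := by
      ext1 i
      cases i using Fin.cases with
      | zero => simp
      | succ i => simp [Fin.succAbove_cycleRange]
    simp only [Equiv.coe_mulLeft, this, Equiv.Perm.sign_mul, Equiv.Perm.mul_apply,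
      Fin.sign_cycleRange]
    have h : ((-1 : ℝ) ^ (a : ℕ)) * (-1) ^ (a : ℕ) = 1 := by
      rw [← mul_pow]; simp
    push_cast
    rw [Fin.val_succ, pow_succ]
    linear_combination (((Equiv.Perm.sign e : ℤ) : ℝ) * Φ (Fin.cons a.succ fun i =>
      a.succ.succAbove (a.cycleRange (e i)))) * h

/-- `∑_{a} (-1)^a = 0` over an even range. -/
lemma sum_neg_one_pow_even (P : ℕ) : ∑ a : Fin (2 * P), (-1 : ℝ) ^ (a : ℕ) = 0 := by
  rw [Fin.sum_univ_eq_sum_range (fun a => (-1 : ℝ) ^ a) (2 * P)]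
  induction P with
  | zero => simp
  | succ P ih =>
    rw [show 2 * (P + 1) = 2 * P + 1 + 1 by ring, Finset.sum_range_succ, Finset.sum_range_succ, ih]
    ring

/-- The sign of the comparison of two elements of a linear order. -/
noncomputable def cmpSign {α : Type*} [LinearOrder α] (a b : α) : ℝ :=
  if a < b then 1 else if b < a then -1 else 0

lemma cmpSign_succAbove {n : ℕ} (p : Fin (n + 1)) (a b : Fin n) :
    cmpSign (p.succAbove a) (p.succAbove b) = cmpSign a b := by
  simp [cmpSign, Fin.succAbove_lt_succAbove_iff]

lemma sum_succAbove_cmpSign {n : ℕ} (a : Fin (n + 1)) :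
    ∑ b : Fin n, (-1 : ℝ) ^ (b : ℕ) * cmpSign a (a.succAbove b) =
      (-1) ^ (a : ℕ) - ∑ b : Fin (n + 1), (-1 : ℝ) ^ (b : ℕ) := by
  rw [Fin.sum_univ_succAbove _ a, ← sub_sub, sub_self, zero_sub, ← Finset.sum_neg_distrib]
  refine Finset.sum_congr rfl fun b _ => ?_
  rcases lt_or_ge b.castSucc a with h | h
  · rw [Fin.succAbove_of_castSucc_lt _ _ h]
    simp [cmpSign, h, h.not_gt]
  · rw [Fin.succAbove_of_le_castSucc _ _ h]
    have : a < b.succ := lt_of_le_of_lt h (Fin.castSucc_lt_succ)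
    simp [cmpSign, this, pow_succ]

/-- The alternating sum computing `2^P P!` times the Pfaffian of the matrix `sgn(j - i)`. -/
lemma pfSum_cmpSign (P : ℕ) :
    pfSum (fun _ : Fin P => fun a b : Fin (2 * P) => cmpSign a b) = 2 ^ P * P.factorial := by
  induction P with
  | zero => simp [pfSum]
  | succ P ih =>
    have e1 : pfSum (fun _ : Fin (P + 1) => fun a b : Fin (2 * (P + 1)) => cmpSign a b) =
        ∑ σ : Equiv.Perm (Fin (2 * P + 1 + 1)), ((Equiv.Perm.sign σ : ℤ) : ℝ) *
          (cmpSign (σ 0) (σ 1) * ∏ i : Fin P,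
            cmpSign (σ (pairFst i).succ.succ) (σ (pairSnd i).succ.succ)) := by
      unfold pfSum
      refine Finset.sum_congr rfl fun σ _ => ?_
      rw [Fin.prod_univ_succ]
      rfl
    rw [e1, sum_sign_perm_succ (fun σ => cmpSign (σ 0) (σ 1) * ∏ i : Fin P,
            cmpSign (σ (pairFst i).succ.succ) (σ (pairSnd i).succ.succ))]
    have e2 : ∀ a : Fin (2 * P + 1 + 1), ∑ e : Equiv.Perm (Fin (2 * P + 1)),
        ((Equiv.Perm.sign e : ℤ) : ℝ) * (cmpSign a (a.succAbove (e 0)) * ∏ i : Fin P,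
          cmpSign (e (pairFst i).succ) (e (pairSnd i).succ)) =
        ((-1) ^ (a : ℕ) - ∑ b : Fin (2 * P + 1 + 1), (-1 : ℝ) ^ (b : ℕ)) *
          (2 ^ P * P.factorial) := by
      intro a
      rw [sum_sign_perm_succ (fun e => cmpSign a (a.succAbove (e 0)) * ∏ i : Fin P,
          cmpSign (e (pairFst i).succ) (e (pairSnd i).succ)), ← sum_succAbove_cmpSign,
          Finset.sum_mul, ← ih]
      refine Finset.sum_congr rfl fun b _ => ?_
      simp only [Fin.cons_zero, Fin.cons_succ, cmpSign_succAbove]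
      rw [pfSum, mul_assoc, Finset.mul_sum _ _ (cmpSign _ _)]
      congr 1
      exact Finset.sum_congr rfl fun e _ => by ring
    have e3 : ∑ b : Fin (2 * P + 1 + 1), (-1 : ℝ) ^ (b : ℕ) = 0 := sum_neg_one_pow_even (P + 1)
    have c1 : (1 : Fin (2 * P + 1 + 1)) = Fin.succ 0 := rfl
    simp only [Fin.cons_zero, Fin.cons_succ, c1, cmpSign_succAbove, e2, e3, sub_zero]
    simp only [← mul_assoc, ← mul_pow]
    simp only [mul_neg, mul_one, neg_neg, one_pow, one_mul, Finset.sum_const, Finset.card_univ,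
      Fintype.card_fin, nsmul_eq_mul]
    rw [Nat.factorial_succ]
    push_cast
    ring

/-- Antisymmetry of the Pfaffian sum under simultaneous relabelling. -/
lemma pfSum_comp_label {P : ℕ} (α : Fin (2 * P) → ℝ) (ρ : Equiv.Perm (Fin (2 * P))) :
    pfSum (fun _ : Fin P => fun a b => Real.sign (α (ρ b) - α (ρ a))) =
      ((Equiv.Perm.sign ρ : ℤ) : ℝ) *
        pfSum (fun _ : Fin P => fun a b => Real.sign (α b - α a)) := by
  unfold pfSum
  rw [← Equiv.sum_comp (Equiv.mulLeft ρ)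
    (fun σ => ((Equiv.Perm.sign σ : ℤ) : ℝ) * ∏ i : Fin P,
      Real.sign (α (σ (pairSnd i)) - α (σ (pairFst i)))), Finset.mul_sum]
  refine Finset.sum_congr rfl fun σ _ => ?_
  have h : ((Equiv.Perm.sign ρ : ℤ) : ℝ) * ((Equiv.Perm.sign ρ : ℤ) : ℝ) = 1 := by
    norm_cast; simp
  simp only [Equiv.coe_mulLeft, Equiv.Perm.sign_mul, Equiv.Perm.coe_mul, Function.comp]
  push_cast
  rw [← mul_assoc, ← mul_assoc, h, one_mul]

lemma vandermonde_comp_perm {n : ℕ} (α : Fin n → ℝ) (ρ : Equiv.Perm (Fin n)) :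
    (Matrix.vandermonde (α ∘ ρ)).det =
      ((Equiv.Perm.sign ρ : ℤ) : ℝ) * (Matrix.vandermonde α).det := by
  rw [← Matrix.det_permute]
  rfl

/-- The Pfaffian of `sgn(α_j - α_i)` is the sign of the Vandermonde determinant. -/
lemma vandermonde_mul_pfSum_sign {P : ℕ} (α : Fin (2 * P) → ℝ) :
    (Matrix.vandermonde α).det * pfSum (fun _ : Fin P => fun a b => Real.sign (α b - α a)) =
      2 ^ P * P.factorial * |(Matrix.vandermonde α).det| := by
  by_cases hinj : Function.Injective α
  · have hmono : StrictMono (α ∘ Tuple.sort α) :=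
      (Tuple.monotone_sort α).strictMono_of_injective (hinj.comp (Tuple.sort α).injective)
    set ρ := Tuple.sort α
    have h1 : pfSum (fun _ : Fin P => fun a b => Real.sign (α (ρ b) - α (ρ a))) =
        2 ^ P * P.factorial := by
      rw [← pfSum_cmpSign]
      congr 1
      ext _ a b
      rcases lt_trichotomy a b with h | h | h
      · have : 0 < α (ρ b) - α (ρ a) := sub_pos.2 (hmono h)
        simp [cmpSign, h, Real.sign_of_pos this]
      · simp [cmpSign, h]
      · have : α (ρ b) - α (ρ a) < 0 := sub_neg.2 (hmono h)
        simp [cmpSign, h, h.not_gt, Real.sign_of_neg this]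
    have h2 : 0 ≤ (Matrix.vandermonde (α ∘ ρ)).det := by
      rw [Matrix.det_vandermonde]
      exact Finset.prod_nonneg fun i _ => Finset.prod_nonneg fun j hj =>
        (sub_pos.2 (hmono (Finset.mem_Ioi.1 hj))).le
    rw [pfSum_comp_label] at h1
    rw [vandermonde_comp_perm] at h2
    rcases Int.units_eq_one_or (Equiv.Perm.sign ρ) with h | h
    · simp only [h, Units.val_one, Int.cast_one, one_mul] at h1 h2
      rw [h1, abs_of_nonneg h2]; ring
    · simp only [h, Units.val_neg, Units.val_one, Int.cast_neg, Int.cast_one] at h1 h2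
      rw [abs_of_nonpos (by linarith)]
      linear_combination -(Matrix.vandermonde α).det * h1
  · have : (Matrix.vandermonde α).det = 0 := by
      rw [Matrix.det_vandermonde_eq_zero_iff]
      simp only [Function.Injective, not_forall] at hinj
      obtain ⟨i, j, h, hne⟩ := hinj
      exact ⟨i, j, h, hne⟩
    simp [this]

end SignSum

section Confluent

lemma prod_Ioi_eq_prod_range {n : ℕ} {R : Type*} [CommMonoid R] (f : ℕ → ℕ → R) :
    ∏ i : Fin n, ∏ j ∈ Ioi i, f i j = ∏ k ∈ range n, ∏ j ∈ range k, f j k := by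
  rw [Finset.prod_comm' (t' := univ) (s' := fun j => Iio j) (by simp),
    ← Fin.prod_univ_eq_prod_range (fun k => ∏ j ∈ range k, f j k)]
  refine prod_congr rfl fun k _ => ?_
  rw [← Nat.Iio_eq_range, ← Fin.map_valEmbedding_Iio, prod_map]
  rfl

/-- The confluent Vandermonde matrix attached to the nodes `x`: the first `2P` columns are
ordinary, the remaining ones come in pairs consisting of a column and its derivative. -/
noncomputable def confluentMatrix (n P : ℕ) (x : ℕ → ℝ) : Matrix (Fin n) (Fin n) ℝ :=
  Matrix.of fun i r =>
    if r.1 < 2 * P ∨ r.1 % 2 = 0 then x r ^ i.1 else (i.1 : ℝ) * x (r - 1) ^ (i.1 - 1)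

lemma confluentMatrix_succ (n P : ℕ) (x : ℕ → ℝ) (h : 2 * P + 1 < n) (c : ℝ) :
    confluentMatrix n (P + 1) (Function.update x (2 * P + 1) c) =
      (confluentMatrix n P x).updateCol ⟨2 * P + 1, h⟩ (fun i => c ^ i.1) := by
  ext i r
  by_cases hr : r = ⟨2 * P + 1, h⟩
  · subst hr
    simp [confluentMatrix]
    omega
  · rw [Matrix.updateCol_ne hr]
    have hr' : r.1 ≠ 2 * P + 1 := fun e => hr (Fin.ext e)
    simp only [confluentMatrix, Matrix.of_apply]
    by_cases h1 : r.1 < 2 * P ∨ r.1 % 2 = 0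
    · rw [if_pos (by omega), if_pos h1, Function.update_of_ne hr']
    · rw [if_neg (by omega), if_neg h1, Function.update_of_ne (by omega)]

lemma hasDerivAt_det_updateCol_pow {n : ℕ} (A : Matrix (Fin n) (Fin n) ℝ) (r : Fin n) (a : ℝ) :
    HasDerivAt (fun c : ℝ => (A.updateCol r fun i => c ^ i.1).det)
      (A.updateCol r fun i => (i.1 : ℝ) * a ^ (i.1 - 1)).det a := by
  have hv : HasDerivAt (fun c : ℝ => fun i : Fin n => c ^ i.1)
      (fun i : Fin n => (i.1 : ℝ) * a ^ (i.1 - 1)) a :=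
    hasDerivAt_pi.2 fun i => hasDerivAt_pow i.1 a
  let L : (Fin n → ℝ) →ₗ[ℝ] ℝ := (LinearMap.proj r).comp A.cramer
  have := (LinearMap.toContinuousLinearMap L).hasFDerivAt.comp_hasDerivAt a hv
  simpa [L, Matrix.cramer_apply, Function.comp_def] using this

lemma det_confluentMatrix (M : ℕ) : ∀ (n P : ℕ) (x : ℕ → ℝ), n = 2 * (P + M) →
    (confluentMatrix n P x).det =
      (∏ k ∈ range (2 * P), ∏ j ∈ range k, (x k - x j)) *
      (∏ k ∈ range M, ∏ j ∈ range (2 * P), (x (2 * (P + k)) - x j) ^ 2) *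
      ∏ k ∈ range M, ∏ j ∈ range k, (x (2 * (P + k)) - x (2 * (P + j))) ^ 4 := by
  induction M with
  | zero =>
    rintro n P x rfl
    have : (confluentMatrix (2 * (P + 0)) P x)
        = (Matrix.vandermonde fun r : Fin (2 * P) => x r).transpose := by
      ext i r
      simp [confluentMatrix, Matrix.vandermonde]
    rw [this, Matrix.det_transpose, Matrix.det_vandermonde]
    simp only [range_zero, prod_empty, mul_one]
    exact prod_Ioi_eq_prod_range fun j k => x k - x j
  | succ M ih =>
    intro n P x hn
    have hlt : 2 * P + 1 < n := by omega
    set A := confluentMatrix n P x with hA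
    have hA' : A.updateCol ⟨2 * P + 1, hlt⟩ (fun i => (i.1 : ℝ) * x (2 * P) ^ (i.1 - 1)) = A := by
      ext i r
      by_cases hr : r = ⟨2 * P + 1, hlt⟩
      · subst hr
        simp [A, confluentMatrix]
      · rw [Matrix.updateCol_ne hr]
    have hd := hasDerivAt_det_updateCol_pow A ⟨2 * P + 1, hlt⟩ (x (2 * P))
    rw [hA'] at hd
    let G : ℝ → ℝ := fun c =>
      (∏ k ∈ range (2 * P), ∏ j ∈ range k, (x k - x j)) *
      (∏ j ∈ range (2 * P), (x (2 * P) - x j)) * (∏ j ∈ range (2 * P), (c - x j)) *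
      ((∏ k ∈ range M, ∏ j ∈ range (2 * P), (x (2 * (P + 1 + k)) - x j) ^ 2) *
      (∏ k ∈ range M, (x (2 * (P + 1 + k)) - x (2 * P)) ^ 2) *
      (∏ k ∈ range M, (x (2 * (P + 1 + k)) - c) ^ 2)) *
      ∏ k ∈ range M, ∏ j ∈ range k, (x (2 * (P + 1 + k)) - x (2 * (P + 1 + j))) ^ 4
    have hG : ∀ c, (A.updateCol ⟨2 * P + 1, hlt⟩ fun i => c ^ i.1).det =
        (c - x (2 * P)) * G c := by
      intro c
      rw [hA, ← confluentMatrix_succ, ih n (P + 1) _ (by omega)]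
      have u0 : Function.update x (2 * P + 1) c (2 * P + 1) = c := by simp
      have u1 : ∀ k, k < 2 * P + 1 → Function.update x (2 * P + 1) c k = x k :=
        fun k hk => Function.update_of_ne (by omega) _ _
      have u2 : ∀ k, Function.update x (2 * P + 1) c (2 * k) = x (2 * k) :=
        fun k => Function.update_of_ne (by omega) _ _
      have p1 : ∀ (m : ℕ), m ≤ 2 * P + 1 → ∀ y : ℝ,
          ∏ j ∈ range m, (y - Function.update x (2 * P + 1) c j) = ∏ j ∈ range m, (y - x j) := by
        intro m hm y
        refine prod_congr rfl fun j hj => ?_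
        rw [u1 j (by have := mem_range.1 hj; omega)]
      have p2 : ∏ k ∈ range (2 * P), ∏ j ∈ range k,
          (Function.update x (2 * P + 1) c k - Function.update x (2 * P + 1) c j) =
          ∏ k ∈ range (2 * P), ∏ j ∈ range k, (x k - x j) := by
        refine prod_congr rfl fun k hk => ?_
        have := mem_range.1 hk
        rw [p1 k (by omega), u1 k (by omega)]
      simp only [u2, show 2 * (P + 1) = 2 * P + 1 + 1 by ring, prod_range_succ _ (2 * P + 1),
        prod_range_succ _ (2 * P), u0, p2, prod_pow, p1 (2 * P) (Nat.le_succ _), G,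
        prod_mul_distrib]
      ring
    have hd2 : HasDerivAt (fun c => (c - x (2 * P)) * G c) (G (x (2 * P))) (x (2 * P)) := by
      have hGd : DifferentiableAt ℝ G (x (2 * P)) := by
        simp only [G]
        fun_prop
      have := ((hasDerivAt_id (x (2 * P))).sub_const (x (2 * P))).mul hGd.hasDerivAt
      simp only [id, sub_self, zero_mul, add_zero, one_mul] at this
      exact this
    rw [funext hG] at hd
    rw [hd.unique hd2]
    have q : ∀ k, x (2 * (P + 1 + k)) = x (2 * (P + (k + 1))) :=
      fun k => by rw [add_assoc, add_comm 1]
    simp only [G, prod_range_succ', q, add_zero, range_zero, prod_empty, mul_one,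
      prod_mul_distrib, prod_pow]
    ring

end Confluent

section Determinant

/-- The nodes `α` (ordinary, in positions `r < 2P`) followed by the doubled nodes `β`. -/
noncomputable def nodes {P M : ℕ} (α : Fin (2 * P) → ℝ) (β : Fin M → ℝ) (r : ℕ) : ℝ :=
  if h : r < 2 * P then α ⟨r, h⟩ else if h : r / 2 - P < M then β ⟨r / 2 - P, h⟩ else 0

lemma nodes_fst {P M : ℕ} (α : Fin (2 * P) → ℝ) (β : Fin M → ℝ) (j : Fin (2 * P)) :
    nodes α β j = α j := by
  simp [nodes]

lemma nodes_snd {P M : ℕ} (α : Fin (2 * P) → ℝ) (β : Fin M → ℝ) (k : Fin M) :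
    nodes α β (2 * (P + k)) = β k := by
  simp [nodes]

lemma det_confluentMatrix_nodes {P M : ℕ} (α : Fin (2 * P) → ℝ) (β : Fin M → ℝ) :
    (confluentMatrix (2 * (P + M)) P (nodes α β)).det =
      (Matrix.vandermonde α).det * ((∏ j, ∏ k, (α j - β k) ^ 2) *
        ∏ j, ∏ k ∈ Ioi j, (β k - β j) ^ 4) := by
  have hc : ∏ j, ∏ k, (α j - β k) ^ 2 = ∏ k, ∏ j, (α j - β k) ^ 2 := prod_comm
  rw [hc, det_confluentMatrix M _ P _ rfl, Matrix.det_vandermonde,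
    ← prod_Ioi_eq_prod_range fun j k => nodes α β k - nodes α β j,
    ← prod_Ioi_eq_prod_range fun j k =>
      (nodes α β (2 * (P + k)) - nodes α β (2 * (P + j))) ^ 4,
    ← Fin.prod_univ_eq_prod_range (fun k => ∏ j ∈ range (2 * P),
      (nodes α β (2 * (P + k)) - nodes α β j) ^ 2), mul_assoc]
  simp only [nodes_fst, nodes_snd]
  congr 2
  refine prod_congr rfl fun k _ => ?_
  rw [← Fin.prod_univ_eq_prod_range (fun j => (β k - nodes α β j) ^ 2)]
  refine prod_congr rfl fun j _ => ?_
  rw [nodes_fst]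
  ring

/-- Leibniz expansion of the confluent Vandermonde determinant, grouped in pairs of columns. -/
lemma det_confluentMatrix_nodes_expand {P M : ℕ} (α : Fin (2 * P) → ℝ) (β : Fin M → ℝ) :
    (confluentMatrix (2 * (P + M)) P (nodes α β)).det =
      ∑ σ : Equiv.Perm (Fin (2 * (P + M))), ((Equiv.Perm.sign σ : ℤ) : ℝ) *
        ((∏ i : Fin P, α (pairFst i) ^ (σ (pairFst (Fin.castAdd M i))).1 *
            α (pairSnd i) ^ (σ (pairSnd (Fin.castAdd M i))).1) *
          ∏ k : Fin M, β k ^ (σ (pairFst (Fin.natAdd P k))).1 *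
            (((σ (pairSnd (Fin.natAdd P k))).1 : ℝ) *
              β k ^ ((σ (pairSnd (Fin.natAdd P k))).1 - 1))) := by
  rw [Matrix.det_apply']
  refine sum_congr rfl fun σ _ => ?_
  rw [prod_pairs, Fin.prod_univ_add]
  congr 2
  · refine prod_congr rfl fun i _ => ?_
    rw [← nodes_fst α β (pairFst i), ← nodes_fst α β (pairSnd i)]
    have := i.isLt
    simp only [confluentMatrix, Matrix.of_apply, pairFst, pairSnd, Fin.val_castAdd]
    rw [if_pos (by omega), if_pos (by omega)]
  · refine prod_congr rfl fun k _ => ?_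
    rw [← nodes_snd α β k]
    simp only [confluentMatrix, Matrix.of_apply, pairFst, pairSnd, Fin.val_natAdd]
    rw [if_pos (by omega), if_neg (by omega), Nat.add_sub_cancel]

end Determinant

section Integration

/-- Regrouping consecutive coordinates in pairs preserves Lebesgue measure. -/
lemma measurePreserving_pairs (P : ℕ) :
    MeasurePreserving (fun (α : Fin (2 * P) → ℝ) (i : Fin P) => (α (pairFst i), α (pairSnd i))) := by
  let ψ : (Fin P → ℝ × ℝ) ≃ᵐ (Fin (2 * P) → ℝ) :=
    { toFun := fun p r => if ((pairEquiv P).symm r).2 = 0 then (p ((pairEquiv P).symm r).1).1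
        else (p ((pairEquiv P).symm r).1).2
      invFun := fun α i => (α (pairFst i), α (pairSnd i))
      left_inv := fun p => by
        ext i <;> simp [← pairEquiv_zero, ← pairEquiv_one]
      right_inv := fun α => by
        ext r
        obtain ⟨⟨i, b⟩, rfl⟩ := (pairEquiv P).surjective r
        fin_cases b <;> simp [← pairEquiv_zero, ← pairEquiv_one]
      measurable_toFun := by
        refine measurable_pi_lambda _ fun r => ?_
        by_cases h : ((pairEquiv P).symm r).2 = 0 <;> simp only [Equiv.coe_fn_mk, h, if_true, if_false] <;>
          fun_prop
      measurable_invFun := by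
        change Measurable fun (α : Fin (2 * P) → ℝ) (i : Fin P) => (α (pairFst i), α (pairSnd i))
        fun_prop }
  have hψ : MeasurePreserving ψ volume volume := by
    refine ⟨ψ.measurable, ?_⟩
    refine (Measure.pi_eq fun s _ => ?_).symm
    have : ψ ⁻¹' Set.univ.pi s =
        Set.univ.pi fun i => s (pairFst i) ×ˢ s (pairSnd i) := by
      ext p
      simp only [Set.mem_preimage, Set.mem_pi, Set.mem_univ, true_imp_iff, Set.mem_prod]
      constructor
      · intro h i
        have h0 := h (pairEquiv P (i, 0))
        have h1 := h (pairEquiv P (i, 1))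
        simp [ψ, pairEquiv_zero, pairEquiv_one] at h0 h1
        simp [← pairEquiv_zero, ← pairEquiv_one] at h0 h1 ⊢
        exact ⟨h0, h1⟩
      · intro h r
        obtain ⟨⟨i, b⟩, rfl⟩ := (pairEquiv P).surjective r
        have := h i
        fin_cases b
        · simpa [ψ, ← pairEquiv_zero] using this.1
        · simpa [ψ, ← pairEquiv_one] using this.2
    rw [MeasurableEquiv.map_apply, this, volume_pi, Measure.pi_pi, prod_pairs]
    exact prod_congr rfl fun i _ => by rw [Measure.volume_eq_prod, Measure.prod_prod]
  exact hψ.symm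

lemma measurePreserving_comp_perm {n : ℕ} (τ : Equiv.Perm (Fin n)) :
    MeasurePreserving (fun (α : Fin n → ℝ) => α ∘ τ) := by
  have h : (fun (α : Fin n → ℝ) => α ∘ τ) =
      MeasurableEquiv.piCongrLeft (fun _ : Fin n => ℝ) τ.symm := by
    funext α i
    have := Equiv.piCongrLeft_apply_apply (fun _ : Fin n => ℝ) τ.symm α (τ i)
    rw [Equiv.symm_apply_apply] at this
    exact this.symm
  rw [h]
  exact volume_measurePreserving_piCongrLeft (fun _ : Fin n => ℝ) τ.symm

lemma integral_comp_of_measurePreserving {X Y : Type*} [MeasurableSpace X] [MeasurableSpace Y]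
    {μ : Measure X} {ν : Measure Y} {f : X → Y} (hf : MeasurePreserving f μ ν) {g : Y → ℝ}
    (hg : Integrable g ν) : ∫ x, g (f x) ∂μ = ∫ y, g y ∂ν := by
  have h := hg.aestronglyMeasurable
  rw [← hf.map_eq] at h ⊢
  exact (integral_map hf.measurable.aemeasurable h).symm

/-- The confluent Vandermonde weight, signed through the consecutive pairs of the `α`s. -/
noncomputable def pairWeight (V1 V2 : ℝ → ℝ) (P M : ℕ)
    (ab : (Fin (2 * P) → ℝ) × (Fin M → ℝ)) : ℝ :=
  (confluentMatrix (2 * (P + M)) P (nodes ab.1 ab.2)).det *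
    ((∏ i : Fin P, (Real.sign (ab.1 (pairSnd i) - ab.1 (pairFst i)) *
      Real.exp (-V1 (ab.1 (pairFst i)) - V1 (ab.1 (pairSnd i))))) *
      ∏ k, Real.exp (-2 * V2 (ab.2 k)))

/-- The **de Bruijn formula** for mixed ordinary and confluent columns. -/
lemma integral_pairWeight (V1 V2 : ℝ → ℝ) (P M : ℕ)
    (h1 : ∀ i j : ℕ, Integrable (fun yz : ℝ × ℝ =>
      yz.1 ^ i * yz.2 ^ j * Real.sign (yz.2 - yz.1) * Real.exp (-V1 yz.1 - V1 yz.2)))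
    (h2 : ∀ i j : ℕ, Integrable (fun y : ℝ =>
      y ^ i * ((j : ℝ) * y ^ (j - 1)) * Real.exp (-2 * V2 y))) :
    Integrable (pairWeight V1 V2 P M) ∧
    ∫ ab, pairWeight V1 V2 P M ab = pfSum (fun i : Fin (P + M) => if i.1 < P then
      (fun a b : Fin (2 * (P + M)) => ∫ yz : ℝ × ℝ, yz.1 ^ a.1 * yz.2 ^ b.1 *
        Real.sign (yz.2 - yz.1) * Real.exp (-V1 yz.1 - V1 yz.2)) else
      (fun a b => ∫ y, y ^ a.1 * ((b.1 : ℝ) * y ^ (b.1 - 1)) * Real.exp (-2 * V2 y))) := by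
  let F : ℕ → ℕ → ℝ × ℝ → ℝ := fun i j yz =>
    yz.1 ^ i * yz.2 ^ j * Real.sign (yz.2 - yz.1) * Real.exp (-V1 yz.1 - V1 yz.2)
  let G : ℕ → ℕ → ℝ → ℝ := fun i j y => y ^ i * ((j : ℝ) * y ^ (j - 1)) * Real.exp (-2 * V2 y)
  let T : Equiv.Perm (Fin (2 * (P + M))) → (Fin P → ℝ × ℝ) × (Fin M → ℝ) → ℝ := fun σ pb =>
    (∏ i : Fin P, F (σ (pairFst (Fin.castAdd M i))) (σ (pairSnd (Fin.castAdd M i))) (pb.1 i)) *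
    ∏ k : Fin M, G (σ (pairFst (Fin.natAdd P k))) (σ (pairSnd (Fin.natAdd P k))) (pb.2 k)
  have hT : ∀ σ, Integrable (T σ) := fun σ =>
    Integrable.mul_prod (Integrable.fintype_prod fun i => h1 _ _)
      (Integrable.fintype_prod fun i => h2 _ _)
  have hTi : ∀ σ, ∫ pb, T σ pb =
      (∏ i : Fin P, ∫ yz,
        F (σ (pairFst (Fin.castAdd M i))) (σ (pairSnd (Fin.castAdd M i))) yz) *
      ∏ k : Fin M, ∫ y, G (σ (pairFst (Fin.natAdd P k))) (σ (pairSnd (Fin.natAdd P k))) y := by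
    intro σ
    rw [← integral_fintype_prod_volume_eq_prod, ← integral_fintype_prod_volume_eq_prod,
      ← integral_prod_mul]
    rfl
  have hφ := (measurePreserving_pairs P).prod
    (MeasurePreserving.id (volume : Measure (Fin M → ℝ)))
  have hS : Integrable fun pb => ∑ σ, ((Equiv.Perm.sign σ : ℤ) : ℝ) * T σ pb :=
    integrable_finsetSum _ fun σ _ => (hT σ).const_mul _
  have hW : pairWeight V1 V2 P M = fun ab => (fun pb => ∑ σ, ((Equiv.Perm.sign σ : ℤ) : ℝ) * T σ pb)
      (Prod.map (fun (α : Fin (2 * P) → ℝ) (i : Fin P) => (α (pairFst i), α (pairSnd i))) id ab) := by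
    ext ab
    simp only [pairWeight, det_confluentMatrix_nodes_expand, Finset.sum_mul]
    refine sum_congr rfl fun σ _ => ?_
    simp only [T, F, G, Prod.map_fst, Prod.map_snd, id, prod_mul_distrib]
    ring
  constructor
  · rw [hW]
    exact hφ.integrable_comp_of_integrable hS
  · rw [hW]
    refine (integral_comp_of_measurePreserving hφ hS).trans ?_
    refine (integral_finsetSum _ fun σ _ => (hT σ).const_mul _).trans ?_
    refine sum_congr rfl fun σ _ => ?_
    rw [integral_const_mul, hTi, Fin.prod_univ_add]
    simp [F, G]

lemma sum_pairWeight_comp_perm (V1 V2 : ℝ → ℝ) (P M : ℕ) (α : Fin (2 * P) → ℝ) (β : Fin M → ℝ) :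
    ∑ τ : Equiv.Perm (Fin (2 * P)), pairWeight V1 V2 P M (α ∘ τ, β) =
      2 ^ P * P.factorial * boltzmann V1 V2 (2 * P) M α β := by
  have hw : ∀ τ : Equiv.Perm (Fin (2 * P)), pairWeight V1 V2 P M (α ∘ τ, β) =
      (((Equiv.Perm.sign τ : ℤ) : ℝ) * ∏ i : Fin P,
        Real.sign (α (τ (pairSnd i)) - α (τ (pairFst i)))) * ((Matrix.vandermonde α).det *
        (((∏ j, ∏ k, (α j - β k) ^ 2) * ∏ j, ∏ k ∈ Ioi j, (β k - β j) ^ 4) *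
        ((∏ j, Real.exp (-V1 (α j))) * ∏ k, Real.exp (-2 * V2 (β k))))) := by
    intro τ
    have e1 : ∏ i : Fin P, Real.exp (-V1 (α (τ (pairFst i))) - V1 (α (τ (pairSnd i)))) =
        ∏ j, Real.exp (-V1 (α j)) := by
      rw [← Equiv.prod_comp τ, prod_pairs]
      exact prod_congr rfl fun i _ => by rw [← Real.exp_add, sub_eq_add_neg]
    have e2 : ∏ j, ∏ k, ((α ∘ τ) j - β k) ^ 2 = ∏ j, ∏ k, (α j - β k) ^ 2 :=
      Equiv.prod_comp τ fun j => ∏ k, (α j - β k) ^ 2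
    simp only [pairWeight]
    rw [det_confluentMatrix_nodes, vandermonde_comp_perm, e2]
    simp only [Function.comp, prod_mul_distrib, e1]
    ring
  have h := vandermonde_mul_pfSum_sign α
  rw [sum_congr rfl fun τ _ => hw τ, ← Finset.sum_mul, ← mul_assoc]
  unfold pfSum at h
  rw [mul_comm (∑ τ : Equiv.Perm (Fin (2 * P)), _) (Matrix.det _), h]
  have e3 : |(Matrix.vandermonde α).det| = ∏ j, ∏ k ∈ Ioi j, |α k - α j| := by
    simp only [Matrix.det_vandermonde, abs_prod]
  rw [e3, boltzmann]
  have a4 : ∀ x : ℝ, |x| ^ 4 = x ^ 4 := fun x => Even.pow_abs (by decide) x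
  simp only [sq_abs, a4]
  ring

/-- Symmetrisation of the signed pair weight into the Boltzmann factor. -/
lemma factorial_mul_integral_pairWeight (V1 V2 : ℝ → ℝ) (P M : ℕ)
    (h : Integrable (pairWeight V1 V2 P M)) :
    ((2 * P).factorial : ℝ) * ∫ ab, pairWeight V1 V2 P M ab =
      2 ^ P * P.factorial * ∫ ab : (Fin (2 * P) → ℝ) × (Fin M → ℝ),
        boltzmann V1 V2 (2 * P) M ab.1 ab.2 := by
  have hτ := fun τ : Equiv.Perm (Fin (2 * P)) => (measurePreserving_comp_perm τ).prod
    (MeasurePreserving.id (volume : Measure (Fin M → ℝ)))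
  rw [← integral_const_mul (2 ^ P * (P.factorial : ℝ))]
  simp only [← sum_pairWeight_comp_perm]
  rw [integral_finsetSum]
  · refine Eq.trans ?_
      (sum_congr rfl fun τ _ => (integral_comp_of_measurePreserving (hτ τ) h).symm)
    simp only [sum_const, card_univ, Fintype.card_perm, Fintype.card_fin, nsmul_eq_mul]
    rfl
  · exact fun τ _ => (hτ τ).integrable_comp_of_integrable h

end Integration

/-- **Proposition 1**: the grand canonical partition function
`Z_N(X) = Σ_{L+2M=2N} (X^L/(L!M!)) Z_{L,M}` of the two-component log-gas equals
`2^N Pf(m_{i,j}(X))_{i,j=0}^{2N-1}`. -/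
theorem statement0 (N : ℕ) (hN : 1 ≤ N) (X : ℝ) (V1 V2 : ℝ → ℝ)
    (hV1 : Measurable V1) (hV2 : Measurable V2)
    (hmom1 : ∀ k : ℕ, Integrable (fun x : ℝ => |x| ^ k * Real.exp (-V1 x)))
    (hmom2 : ∀ k : ℕ, Integrable (fun x : ℝ => |x| ^ k * Real.exp (-2 * V2 x)))
    (hint : ∀ L M : ℕ, L + 2 * M = 2 * N →
      Integrable (fun ab : (Fin L → ℝ) × (Fin M → ℝ) => boltzmann V1 V2 L M ab.1 ab.2))
    (hint2 : ∀ i j : ℕ, Integrable (fun yz : ℝ × ℝ =>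
      yz.1 ^ i * yz.2 ^ j * Real.sign (yz.2 - yz.1) * Real.exp (-V1 yz.1 - V1 yz.2))) :
    ∑ LM ∈ (Finset.range (2 * N + 1) ×ˢ Finset.range (N + 1)).filter
        (fun LM => LM.1 + 2 * LM.2 = 2 * N),
      X ^ LM.1 / ((Nat.factorial LM.1 : ℝ) * (Nat.factorial LM.2 : ℝ)) *
        ∫ ab : (Fin LM.1 → ℝ) × (Fin LM.2 → ℝ), boltzmann V1 V2 LM.1 LM.2 ab.1 ab.2
      = 2 ^ N * pfaffian (Matrix.of fun i j : Fin (2 * N) => moment V1 V2 X i.1 j.1) := by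
  have hdmom : ∀ i j : ℕ, Integrable (fun y : ℝ =>
      y ^ i * ((j : ℝ) * y ^ (j - 1)) * Real.exp (-2 * V2 y)) := by
    intro i j
    refine ((hmom2 (i + (j - 1))).const_mul (j : ℝ)).mono' (by fun_prop)
      (Filter.Eventually.of_forall fun y => le_of_eq ?_)
    simp only [norm_mul, Real.norm_eq_abs, abs_pow, Nat.abs_cast, Real.abs_exp, pow_add]
    ring
  let A : Fin (2 * N) → Fin (2 * N) → ℝ := fun a b => ∫ yz : ℝ × ℝ, yz.1 ^ a.1 * yz.2 ^ b.1 *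
    Real.sign (yz.2 - yz.1) * Real.exp (-V1 yz.1 - V1 yz.2)
  let C : Fin (2 * N) → Fin (2 * N) → ℝ := fun a b =>
    ∫ y, y ^ a.1 * ((b.1 : ℝ) * y ^ (b.1 - 1)) * Real.exp (-2 * V2 y)
  have hC : ∀ a b : Fin (2 * N), C a b =
      b.1 * ∫ y, y ^ (a.1 + b.1 - 1) * Real.exp (-2 * V2 y) := by
    intro a b
    rw [← integral_const_mul]
    refine integral_congr_ae (Filter.Eventually.of_forall fun y => ?_)
    dsimp only
    rcases Nat.eq_zero_or_pos b.1 with h | h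
    · simp [h]
    · rw [Nat.add_sub_assoc h, pow_add]
      ring
  have hm : pfSum (fun _ : Fin N => fun a b : Fin (2 * N) => moment V1 V2 X a b) =
      pfSum (fun _ : Fin N => fun a b => X ^ 2 / 2 * A a b + C a b) := by
    refine pfSum_congr_antisymm _ _ fun a b => ?_
    rw [hC, hC, add_comm b.1 a.1]
    simp only [moment, A]
    rw [add_comm b.1 a.1]
    ring
  have hterm : ∀ P M : ℕ, P + M = N →
      pfSum (fun i : Fin N => if i.1 < P then (fun a b => X ^ 2 / 2 * A a b) else C) =
        X ^ (2 * P) * P.factorial / (2 * P).factorial *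
          ∫ ab : (Fin (2 * P) → ℝ) × (Fin M → ℝ), boltzmann V1 V2 (2 * P) M ab.1 ab.2 := by
    rintro P M rfl
    obtain ⟨hI, hE⟩ := integral_pairWeight V1 V2 P M hint2 hdmom
    have hF := factorial_mul_integral_pairWeight V1 V2 P M hI
    have hs : pfSum (fun i : Fin (P + M) =>
        if i.1 < P then (fun a b => X ^ 2 / 2 * A a b) else C) =
        (X ^ 2 / 2) ^ P * pfSum (fun i : Fin (P + M) => if i.1 < P then A else C) := by
      unfold pfSum
      rw [Finset.mul_sum]
      refine sum_congr rfl fun σ _ => ?_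
      simp [Fin.prod_univ_add, prod_mul_distrib, div_eq_mul_inv]
      ring
    rw [hs, ← hE, div_pow, ← pow_mul]
    have h2 : ((2 * P).factorial : ℝ) ≠ 0 := by positivity
    field_simp
    linear_combination X ^ (2 * P) * hF
  have hN0 : (N.factorial : ℝ) ≠ 0 := by positivity
  rw [pfaffian_eq_pfSum]
  change _ = 2 ^ N * (1 / (2 ^ N * (N.factorial : ℝ)) *
    pfSum (fun _ : Fin N => fun a b : Fin (2 * N) => moment V1 V2 X a b))
  rw [hm, pfSum_add, ← mul_assoc, Finset.mul_sum]
  symm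
  refine sum_bij (fun P _ => (2 * P, N - P)) ?_ ?_ ?_ ?_
  · intro P hP
    have := mem_range.1 hP
    simp only [mem_filter, mem_product, mem_range]
    omega
  · intro P _ Q _ h
    simp only [Prod.mk.injEq] at h
    omega
  · rintro ⟨L, M⟩ h
    simp only [mem_filter, mem_product, mem_range] at h
    refine ⟨N - M, mem_range.2 (by omega), ?_⟩
    simp only [Prod.mk.injEq]
    omega
  · intro P hP
    have hPN : P ≤ N := Nat.lt_succ_iff.1 (mem_range.1 hP)
    rw [hterm P (N - P) (by omega), Nat.cast_choose ℝ hPN]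
    have h1 : (P.factorial : ℝ) ≠ 0 := by positivity
    have h2 : ((2 * P).factorial : ℝ) ≠ 0 := by positivity
    have h3 : ((N - P).factorial : ℝ) ≠ 0 := by positivity
    field_simp
end

section
/- Let ⟨·,·⟩_a and ⟨·,·⟩_b be skew-symmetric bilinear forms on the space of complex polynomials, let X be a scalar, and set ⟨·,·⟩_X := X²⟨·,·⟩_a + ⟨·,·⟩_b. Let {p_j}_{j≥0} be monic polynomials with deg p_j = j (with the convention p_{−1} := 0), and let scalars {ζ_j}_{j≥0} with ζ_0 = 0, {h1_j}_{j≥0}, {h4_j}_{j≥0} with h4_{−1} := 0 satisfy, for all m,n ≥ 0: (i) ⟨p_{2m}, p_{2n+1} − ζ_n p_{2n−1}⟩_a = h1_n δ_{n,m}; (ii) ⟨p_{2m}, p_{2n}⟩_a = 0 and ⟨p_{2n+1} − ζ_n p_{2n−1}, p_{2m+1} − ζ_m p_{2m−1}⟩_a = 0; (iii) ⟨p_{2m}, p_{2n+1}⟩_b = h4_{2n} δ_{n,m} − h4_{2m−1} δ_{m−1,n}; (iv) ⟨p_{2m}, p_{2n}⟩_b = ⟨p_{2m+1}, p_{2n+1}⟩_b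 = 0. Let sequences {α_j} and {ξ_j} satisfy, for all j ≥ 0, h4_{2j+1} α_{j+1} − (X² h1_j + h4_{2j} + ζ_j h4_{2j−1}) α_j + ζ_j h4_{2j−2} α_{j−1} = 0 and ζ_{j+1} h4_{2j} ξ_{j+1} − (X² h1_j + h4_{2j} + ζ_j h4_{2j−1}) ξ_j + h4_{2j−1} ξ_{j−1} = 0, with α_{−1} = ξ_{−1} = 0 and α_0 = ξ_0 = 1, and assume α_m ≠ 0 and ξ_m ≠ 0 for all m. Define Q_{2m}(z) = (1/α_m) Σ_{k=0}^{m} α_k p_{2k}(z) and Q_{2m+1}(z) = (1/ξ_m) Σ_{k=0}^{m} ξ_k (p_{2k+1}(z) − ζ_k p_{2k−1}(z)). Then each Q_n is monic of degree n and the family is skew-orthogonal with respect to ⟨·,·⟩_X: ⟨Q_{2m}, Q_{2n}⟩_X = 0 and ⟨Q_{2m+1}, Q_{2n+1}⟩_X = 0 for all m,n ≥ 0, and ⟨Q_{2n}, Q_{2m+1}⟩_X = 0 whenever n ≠ m. -/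
open Finset Polynomial

/-- A normalized combination of monic polynomials of strictly increasing degree is monic of the
top degree. -/
theorem monic_natDegree_normalized_sum {r : ℕ → ℂ[X]} {d : ℕ → ℕ} (hd : StrictMono d)
    (hr : ∀ k, (r k).Monic ∧ (r k).natDegree = d k) (c : ℕ → ℂ) (m : ℕ) (hc : c m ≠ 0) :
    ((c m)⁻¹ • ∑ k ∈ range (m + 1), c k • r k).Monic ∧
      ((c m)⁻¹ • ∑ k ∈ range (m + 1), c k • r k).natDegree = d m := by
  have hdeg (k : ℕ) : (r k).degree = d k := by
    rw [degree_eq_natDegree (hr k).1.ne_zero, (hr k).2]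
  have hlt : ((c m)⁻¹ • ∑ k ∈ range m, c k • r k).degree < (r m).degree := by
    rw [hdeg, ← mem_degreeLT]
    refine Submodule.smul_mem _ _ (Submodule.sum_mem _ fun k hk => Submodule.smul_mem _ _ ?_)
    rw [mem_degreeLT, hdeg]
    exact_mod_cast hd (mem_range.1 hk)
  rw [sum_range_succ, smul_add, smul_smul, inv_mul_cancel₀ hc, one_smul]
  exact ⟨(hr m).1.add_of_right hlt, by rw [natDegree_add_eq_right_of_degree_lt hlt, (hr m).2]⟩

/-- Pairing a sequence vanishing at `-1` with a column of a tridiagonal matrix. -/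
theorem sum_mul_tridiagonal (a : ℤ → ℂ) (ha : a (-1) = 0) (D U L : ℂ) {n m : ℕ} (h : n < m) :
    ∑ k ∈ range (m + 1), a k * ((if k = n then D else 0) - (if k = n + 1 then U else 0)
      - (if k + 1 = n then L else 0)) = a n * D - a (n + 1) * U - a ((n : ℤ) - 1) * L := by
  simp only [mul_sub, sum_sub_distrib, mul_ite, mul_zero]
  congr 1
  · rw [sum_ite_eq', sum_ite_eq', if_pos (by simp; omega), if_pos (by simp; omega)]
    push_cast
    rfl
  · cases n with
    | zero => simp [ha]
    | succ n =>
      simp only [Nat.add_right_cancel_iff]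
      rw [sum_ite_eq', if_pos (by simp; omega)]
      push_cast
      rw [add_sub_cancel_right]

/-- **Proposition 3 (skew orthogonality)**: given skew symmetric bilinear forms `Ba`, `Bb`
on complex polynomials with the structure (i)-(iv) relative to monic polynomials `p_j`
(with `p_{-1} = 0`), and sequences `α`, `ξ` solving the stated three-term recurrences with
`α_{-1} = ξ_{-1} = 0`, `α_0 = ξ_0 = 1`, the polynomials
`Q_{2m} = α_m⁻¹ Σ_{k≤m} α_k p_{2k}` and `Q_{2m+1} = ξ_m⁻¹ Σ_{k≤m} ξ_k (p_{2k+1} - ζ_k p_{2k-1})`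
are monic of the indicated degree and skew orthogonal for `⟨·,·⟩_X = X²⟨·,·⟩_a + ⟨·,·⟩_b`. -/
theorem statement1
    (Ba Bb : Polynomial ℂ →ₗ[ℂ] Polynomial ℂ →ₗ[ℂ] ℂ)
    (hBa : ∀ φ ψ : Polynomial ℂ, Ba φ ψ = -Ba ψ φ)
    (hBb : ∀ φ ψ : Polynomial ℂ, Bb φ ψ = -Bb ψ φ)
    (X : ℂ)
    (p : ℤ → Polynomial ℂ)
    (hpneg : p (-1) = 0)
    (hmonic : ∀ n : ℕ, (p n).Monic)
    (hdeg : ∀ n : ℕ, (p n).natDegree = n)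
    (ζ h1 : ℕ → ℂ) (h4 : ℤ → ℂ)
    (hζ0 : ζ 0 = 0) (hh4neg : h4 (-1) = 0)
    (hi : ∀ m n : ℕ, Ba (p (2 * m)) (p (2 * n + 1) - ζ n • p (2 * n - 1))
        = if n = m then h1 n else 0)
    (hii : ∀ m n : ℕ, Ba (p (2 * m)) (p (2 * n)) = 0)
    (hii' : ∀ m n : ℕ,
      Ba (p (2 * n + 1) - ζ n • p (2 * n - 1)) (p (2 * m + 1) - ζ m • p (2 * m - 1)) = 0)
    (hiii : ∀ m n : ℕ, Bb (p (2 * m)) (p (2 * n + 1))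
        = (if n = m then h4 (2 * n) else 0)
          - (if (m : ℤ) - 1 = (n : ℤ) then h4 (2 * m - 1) else 0))
    (hiv : ∀ m n : ℕ, Bb (p (2 * m)) (p (2 * n)) = 0)
    (hiv' : ∀ m n : ℕ, Bb (p (2 * m + 1)) (p (2 * n + 1)) = 0)
    (α ξ : ℤ → ℂ)
    (hα : ∀ j : ℕ, h4 (2 * j + 1) * α (j + 1)
        - (X ^ 2 * h1 j + h4 (2 * j) + ζ j * h4 (2 * j - 1)) * α j
        + ζ j * h4 (2 * j - 2) * α ((j : ℤ) - 1) = 0)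
    (hξ : ∀ j : ℕ, ζ (j + 1) * h4 (2 * j) * ξ (j + 1)
        - (X ^ 2 * h1 j + h4 (2 * j) + ζ j * h4 (2 * j - 1)) * ξ j
        + h4 (2 * j - 1) * ξ ((j : ℤ) - 1) = 0)
    (hαneg : α (-1) = 0) (hξneg : ξ (-1) = 0)
    (hα0 : α 0 = 1) (hξ0 : ξ 0 = 1)
    (hαne : ∀ m : ℕ, α m ≠ 0) (hξne : ∀ m : ℕ, ξ m ≠ 0)
    (Q : ℕ → Polynomial ℂ)
    (hQe : ∀ m : ℕ, Q (2 * m) = (α m)⁻¹ • ∑ k ∈ Finset.range (m + 1), α k • p (2 * k))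
    (hQo : ∀ m : ℕ, Q (2 * m + 1)
        = (ξ m)⁻¹ • ∑ k ∈ Finset.range (m + 1), ξ k • (p (2 * k + 1) - ζ k • p (2 * k - 1))) :
    (∀ n : ℕ, (Q n).Monic ∧ (Q n).natDegree = n) ∧
    (∀ m n : ℕ,
      X ^ 2 * Ba (Q (2 * m)) (Q (2 * n)) + Bb (Q (2 * m)) (Q (2 * n)) = 0) ∧
    (∀ m n : ℕ,
      X ^ 2 * Ba (Q (2 * m + 1)) (Q (2 * n + 1)) + Bb (Q (2 * m + 1)) (Q (2 * n + 1)) = 0) ∧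
    (∀ m n : ℕ, n ≠ m →
      X ^ 2 * Ba (Q (2 * n)) (Q (2 * m + 1)) + Bb (Q (2 * n)) (Q (2 * m + 1)) = 0) := by
  set q : ℕ → ℂ[X] := fun k => p (2 * k + 1) - ζ k • p (2 * k - 1) with hq
  set B : ℂ[X] →ₗ[ℂ] ℂ[X] →ₗ[ℂ] ℂ := X ^ 2 • Ba + Bb with hB
  have hBapp (φ ψ : ℂ[X]) : X ^ 2 * Ba φ ψ + Bb φ ψ = B φ ψ := by simp [hB]
  have hqdeg (k : ℕ) : (q k).Monic ∧ (q k).natDegree = 2 * k + 1 := by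
    have hm := hmonic (2 * k + 1)
    have hd := hdeg (2 * k + 1)
    push_cast at hm hd
    have hlt : (ζ k • p (2 * k - 1)).degree < (p (2 * k + 1)).degree := by
      rw [degree_eq_natDegree hm.ne_zero, hd]
      refine (degree_smul_le _ _).trans_lt ?_
      cases k with
      | zero => simp [hpneg]
      | succ k =>
        have e : 2 * ((k + 1 : ℕ) : ℤ) - 1 = ((2 * k + 1 : ℕ) : ℤ) := by push_cast; ring
        rw [e, degree_eq_natDegree (hmonic _).ne_zero, hdeg]
        exact_mod_cast (by omega : 2 * k + 1 < 2 * (k + 1) + 1)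
    exact ⟨hm.sub_of_left hlt,
      (natDegree_eq_of_degree_eq (degree_sub_eq_left_of_degree_lt hlt)).trans hd⟩
  have hpdeg (k : ℕ) : (p (2 * k)).Monic ∧ (p (2 * k)).natDegree = 2 * k := by
    have hm := hmonic (2 * k)
    have hd := hdeg (2 * k)
    push_cast at hm hd
    exact ⟨hm, hd⟩
  have hee (m n : ℕ) : B (p (2 * m)) (p (2 * n)) = 0 := by
    rw [← hBapp, hii, hiv, mul_zero, add_zero]
  have hodd (k : ℕ) : p (2 * k - 1) = 0 ∨ ∃ l : ℕ, p (2 * k - 1) = p (2 * l + 1) := by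
    cases k with
    | zero => left; simpa using hpneg
    | succ l => right; exact ⟨l, by congr 1; push_cast; ring⟩
  have hoo (m n : ℕ) : B (q m) (q n) = 0 := by
    rw [← hBapp, hii', mul_zero, zero_add]
    simp only [hq, map_sub, map_smul, LinearMap.sub_apply, LinearMap.smul_apply, hiv']
    rcases hodd m with h | ⟨l, h⟩ <;> rcases hodd n with h' | ⟨l', h'⟩ <;>
      simp [h, h', hiv']
  have heo (m n : ℕ) : B (p (2 * m)) (q n) =
      (if m = n then X ^ 2 * h1 n + h4 (2 * n) + ζ n * h4 (2 * n - 1) else 0)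
        - (if m = n + 1 then h4 (2 * n + 1) else 0)
        - (if m + 1 = n then ζ n * h4 (2 * n - 2) else 0) := by
    rw [← hBapp, hi]
    simp only [hq, map_sub, map_smul, hiii, smul_eq_mul]
    have c1 : ((m : ℤ) - 1 = n) ↔ m = n + 1 := by omega
    have e1 : (if m = n + 1 then h4 (2 * m - 1) else 0)
        = if m = n + 1 then h4 (2 * n + 1) else 0 := by
      split_ifs with h
      · subst h; congr 1; push_cast; ring
      · rfl
    simp only [c1, e1, eq_comm (a := n) (b := m)]
    cases n with
    | zero => by_cases h : m = 0 <;> simp [h, hζ0, hpneg]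
    | succ l =>
      have e : 2 * ((l + 1 : ℕ) : ℤ) - 1 = 2 * l + 1 := by push_cast; ring
      have e' : 2 * ((l + 1 : ℕ) : ℤ) - 2 = 2 * l := by push_cast; ring
      have c2 : ((m : ℤ) - 1 = l) ↔ m = l + 1 := by omega
      have e2 : (if m = l + 1 then h4 (2 * m - 1) else 0)
          = if m = l + 1 then h4 (2 * l + 1) else 0 := by
        split_ifs with h
        · subst h; rw [e]
        · rfl
      rw [e, e', hiii]
      simp only [c2, e2, Nat.add_right_cancel_iff, eq_comm (a := l) (b := m)]
      split_ifs <;> ring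
  have hcol (m n : ℕ) (h : n < m) :
      B (∑ k ∈ range (m + 1), α k • p (2 * k)) (q n) = 0 := by
    simp only [map_sum, map_smul, LinearMap.sum_apply, LinearMap.smul_apply, smul_eq_mul, heo]
    rw [sum_mul_tridiagonal α hαneg _ _ _ h]
    linear_combination -hα n
  have hrow (m n : ℕ) (h : n < m) :
      B (p (2 * n)) (∑ k ∈ range (m + 1), ξ k • q k) = 0 := by
    have key (k : ℕ) : B (p (2 * n)) (q k) =
        (if k = n then X ^ 2 * h1 n + h4 (2 * n) + ζ n * h4 (2 * n - 1) else 0)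
          - (if k = n + 1 then ζ (n + 1) * h4 (2 * n) else 0)
          - (if k + 1 = n then h4 (2 * n - 1) else 0) := by
      rw [heo]
      rcases lt_trichotomy k n with hk | rfl | hk
      · by_cases hk' : k + 1 = n
        · subst hk'
          rw [if_neg (by omega), if_pos rfl, if_neg (by omega), if_neg (by omega),
            if_neg (by omega), if_pos rfl]
          have e : 2 * ((k + 1 : ℕ) : ℤ) - 1 = 2 * k + 1 := by push_cast; ring
          rw [e]
          ring
        · rw [if_neg (by omega), if_neg (by omega), if_neg (by omega), if_neg (by omega),
            if_neg (by omega), if_neg hk']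
      · simp
      · by_cases hk' : k = n + 1
        · subst hk'
          rw [if_neg (by omega), if_neg (by omega), if_pos rfl, if_neg (by omega), if_pos rfl,
            if_neg (by omega)]
          have e : 2 * ((n + 1 : ℕ) : ℤ) - 2 = 2 * n := by push_cast; ring
          rw [e]
          ring
        · rw [if_neg (by omega), if_neg (by omega), if_neg (by omega), if_neg (by omega),
            if_neg hk', if_neg (by omega)]
    simp only [map_sum, map_smul, smul_eq_mul, key]
    rw [sum_mul_tridiagonal ξ hξneg _ _ _ h]
    linear_combination -hξ n
  have hQo' (m : ℕ) : Q (2 * m + 1) = (ξ m)⁻¹ • ∑ k ∈ range (m + 1), ξ k • q k := hQo m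
  refine ⟨fun n => ?_, fun m n => ?_, fun m n => ?_, fun m n hnm => ?_⟩
  · rcases Nat.even_or_odd' n with ⟨m, rfl | rfl⟩
    · rw [hQe]
      exact monic_natDegree_normalized_sum (d := fun k => 2 * k) (fun a b h => by simpa using h)
        hpdeg (fun k => α k) m (hαne m)
    · rw [hQo']
      exact monic_natDegree_normalized_sum (d := fun k => 2 * k + 1)
        (fun a b h => by simpa using h) hqdeg (fun k => ξ k) m (hξne m)
  · rw [hBapp, hQe, hQe]
    simp [map_sum, LinearMap.sum_apply, hee]
  · rw [hBapp, hQo', hQo']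
    simp [map_sum, LinearMap.sum_apply, hoo]
  · rw [hBapp, hQe, hQo']
    rw [map_smul, map_smul, LinearMap.smul_apply]
    suffices h0 : B (∑ k ∈ range (n + 1), α k • p (2 * k)) (∑ k ∈ range (m + 1), ξ k • q k) = 0 by
      rw [h0, smul_zero, smul_zero]
    rcases lt_or_gt_of_ne hnm with h | h
    · rw [map_sum B, LinearMap.sum_apply]
      refine sum_eq_zero fun k hk => ?_
      rw [map_smul, LinearMap.smul_apply, hrow m k (by have := mem_range.1 hk; omega), smul_zero]
    · rw [map_sum]
      refine sum_eq_zero fun k hk => ?_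
      rw [map_smul, hcol n k (by have := mem_range.1 hk; omega), smul_zero]
end

section
/- Let X and scalars {ζ_j}_{j≥0} with ζ_0 = 0 and ζ_j ≠ 0 for j ≥ 1, {h1_j}_{j≥0}, and {h4_j}_{j≥0} with h4_j ≠ 0 for all j ≥ 0 and h4_{−1} := 0 be given. Suppose the sequence {α_j} satisfies h4_{2j+1} α_{j+1} − (X² h1_j + h4_{2j} + ζ_j h4_{2j−1}) α_j + ζ_j h4_{2j−2} α_{j−1} = 0 for all j ≥ 0 with α_{−1} = 0, α_0 = 1, and the sequence {ξ_j} satisfies ζ_{j+1} h4_{2j} ξ_{j+1} − (X² h1_j + h4_{2j} + ζ_j h4_{2j−1}) ξ_j + h4_{2j−1} ξ_{j−1} = 0 for all j ≥ 0 with ξ_{−1} = 0, ξ_0 = 1. Then for every j ≥ 0, ξ_j = c_j^{−1} α_j, where c_j = ∏_{k=1}^{j} ζ_k h4_{2k−2} / h4_{2k−1} (so c_0 = 1). -/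
open Finset

/-- **Corollary (coupling of the coefficient sequences)**: if `α` and `ξ` satisfy the two
three-term recurrences of the two-component log-gas with the same initial data
`α_{-1} = ξ_{-1} = 0`, `α_0 = ξ_0 = 1`, then `ξ_j = c_j⁻¹ α_j` where
`c_j = Π_{k=1}^{j} ζ_k h4_{2k-2} / h4_{2k-1}`. -/
theorem statement2 {F : Type*} [Field F]
    (X : F) (ζ h1 : ℕ → F) (h4 : ℤ → F)
    (hζ0 : ζ 0 = 0) (hζne : ∀ j : ℕ, 1 ≤ j → ζ j ≠ 0)
    (hh4neg : h4 (-1) = 0) (hh4ne : ∀ j : ℕ, h4 (j : ℤ) ≠ 0)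
    (α ξ : ℤ → F)
    (hα : ∀ j : ℕ, h4 (2 * j + 1) * α (j + 1)
        - (X ^ 2 * h1 j + h4 (2 * j) + ζ j * h4 (2 * j - 1)) * α j
        + ζ j * h4 (2 * j - 2) * α ((j : ℤ) - 1) = 0)
    (hαneg : α (-1) = 0) (hα0 : α 0 = 1)
    (hξ : ∀ j : ℕ, ζ (j + 1) * h4 (2 * j) * ξ (j + 1)
        - (X ^ 2 * h1 j + h4 (2 * j) + ζ j * h4 (2 * j - 1)) * ξ j
        + h4 (2 * j - 1) * ξ ((j : ℤ) - 1) = 0)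
    (hξneg : ξ (-1) = 0) (hξ0 : ξ 0 = 1) :
    ∀ j : ℕ,
      ξ j = (∏ k ∈ Finset.Icc 1 j, ζ k * h4 (2 * k - 2) / h4 (2 * k - 1))⁻¹ * α j := by
  have h_even (j : ℕ) : h4 (2 * j) ≠ 0 := mod_cast hh4ne (2 * j)
  have h_odd (j : ℕ) : h4 (2 * j + 1) ≠ 0 := mod_cast hh4ne (2 * j + 1)
  have h_zeta (j : ℕ) : ζ (j + 1) ≠ 0 := hζne _ (Nat.le_add_left 1 j)
  set c : ℕ → F := fun j ↦ ∏ k ∈ Finset.Icc 1 j, ζ k * h4 (2 * k - 2) / h4 (2 * k - 1) with hc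
  have c_zero : c 0 = 1 := by simp [hc]
  have c_succ (j : ℕ) : c (j + 1) * h4 (2 * j + 1) = c j * (ζ (j + 1) * h4 (2 * j)) := by
    have e₁ : 2 * ((j + 1 : ℕ) : ℤ) - 2 = 2 * j := by push_cast; ring
    have e₂ : 2 * ((j + 1 : ℕ) : ℤ) - 1 = 2 * j + 1 := by push_cast; ring
    have := h_odd j
    simp only [hc, Finset.prod_Icc_succ_top (Nat.le_add_left 1 j), e₁, e₂]
    field_simp
  have c_ne (j : ℕ) : c j ≠ 0 := by
    induction j with
    | zero => simp [c_zero]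
    | succ j ih =>
      refine left_ne_zero_of_mul (b := h4 (2 * j + 1)) ?_
      rw [c_succ]
      exact mul_ne_zero ih (mul_ne_zero (h_zeta j) (h_even j))
  have key (j : ℕ) : c j * ξ j = α j ∧ c (j + 1) * ξ (j + 1) = α (j + 1) := by
    induction j with
    | zero =>
      have ha := hα 0
      have hx := hξ 0
      have hs := c_succ 0
      have ho := h_odd 0
      simp only [Nat.cast_zero, mul_zero, zero_add, zero_sub, hζ0, hh4neg, hα0, hξ0, hαneg,
        hξneg, c_zero] at ha hx hs ho ⊢
      refine ⟨by ring, mul_left_cancel₀ ho ?_⟩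
      linear_combination ξ 1 * hs + hx - ha
    | succ j ih =>
      obtain ⟨ih₀, ih₁⟩ := ih
      refine ⟨mod_cast ih₁, mul_left_cancel₀ (h_odd (j + 1)) ?_⟩
      have ha := hα (j + 1)
      have hx := hξ (j + 1)
      have hs := c_succ (j + 1)
      have e₁ : 2 * ((j + 1 : ℕ) : ℤ) - 2 = 2 * j := by push_cast; ring
      have e₂ : 2 * ((j + 1 : ℕ) : ℤ) - 1 = 2 * j + 1 := by push_cast; ring
      have e₃ : ((j + 1 : ℕ) : ℤ) - 1 = j := by push_cast; ring
      rw [e₁, e₂, e₃, ← ih₀] at ha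
      rw [e₂, e₃] at hx
      have ih₂ : c (j + 1) * ξ ((j + 1 : ℕ) : ℤ) = α ((j + 1 : ℕ) : ℤ) := mod_cast ih₁
      rw [← ih₂] at ha
      linear_combination ξ (((j + 1 : ℕ) : ℤ) + 1) * hs + c (j + 1) * hx - ha - ξ j * c_succ j
  intro j
  exact (eq_inv_mul_iff_mul_eq₀ (c_ne j)).mpr (key j).1
end

section
/- Under the hypotheses of the construction of skew orthogonal polynomials for a two-component inner product — namely: ⟨·,·⟩_a, ⟨·,·⟩_b skew-symmetric bilinear forms on complex polynomials, ⟨·,·⟩_X := X²⟨·,·⟩_a + ⟨·,·⟩_b; monic polynomials {p_j} with deg p_j = j and p_{−1} := 0; scalars {ζ_j} with ζ_0 = 0, {h1_j}, {h4_j} with h4_{−1} := 0 satisfying ⟨p_{2m}, p_{2n+1} − ζ_n p_{2n−1}⟩_a = h1_n δ_{n,m}, ⟨p_{2m}, p_{2n}⟩_a = ⟨p_{2n+1} − ζ_n p_{2n−1}, p_{2m+1} − ζ_m p_{2m−1}⟩_a = 0, ⟨p_{2m}, p_{2n+1}⟩_b = h4_{2n} δ_{n,m} − h4_{2m−1} δ_{m−1,n},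 ⟨p_{2m}, p_{2n}⟩_b = ⟨p_{2m+1}, p_{2n+1}⟩_b = 0; sequences α, ξ solving h4_{2j+1} α_{j+1} − (X² h1_j + h4_{2j} + ζ_j h4_{2j−1}) α_j + ζ_j h4_{2j−2} α_{j−1} = 0 and ζ_{j+1} h4_{2j} ξ_{j+1} − (X² h1_j + h4_{2j} + ζ_j h4_{2j−1}) ξ_j + h4_{2j−1} ξ_{j−1} = 0 with α_{−1} = ξ_{−1} = 0, α_0 = ξ_0 = 1 and α_m, ξ_m ≠ 0 for all m; and Q_{2m} = (1/α_m) Σ_{k=0}^{m} α_k p_{2k}, Q_{2m+1} = (1/ξ_m) Σ_{k=0}^{m} ξ_k (p_{2k+1} − ζ_k p_{2k−1}) — one has, for every n ≥ 0, ⟨Q_{2n}, Q_{2n+1}⟩_X = h4_{2n+1} · α_{n+1}/α_n, and consequently for every N ≥ 1, ∏_{j=0}^{N−1} ⟨Q_{2j}, Q_{2j+1}⟩_X = α_N · ∏_{j=0}^{N−1} h4_{2j+1}. -/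
open Finset Polynomial

/-- **Normalisation of the skew orthogonal polynomials / partition function identity**:
under the hypotheses of the construction of the skew orthogonal polynomials `Q_n` for the
two-component inner product `⟨·,·⟩_X = X²⟨·,·⟩_a + ⟨·,·⟩_b`, one has
`⟨Q_{2n}, Q_{2n+1}⟩_X = h4_{2n+1} α_{n+1}/α_n` and hence
`Π_{j=0}^{N-1} ⟨Q_{2j}, Q_{2j+1}⟩_X = α_N Π_{j=0}^{N-1} h4_{2j+1}`. -/
theorem statement3
    (Ba Bb : Polynomial ℂ →ₗ[ℂ] Polynomial ℂ →ₗ[ℂ] ℂ)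
    (hBa : ∀ φ ψ : Polynomial ℂ, Ba φ ψ = -Ba ψ φ)
    (hBb : ∀ φ ψ : Polynomial ℂ, Bb φ ψ = -Bb ψ φ)
    (X : ℂ)
    (p : ℤ → Polynomial ℂ)
    (hpneg : p (-1) = 0)
    (hmonic : ∀ n : ℕ, (p n).Monic)
    (hdeg : ∀ n : ℕ, (p n).natDegree = n)
    (ζ h1 : ℕ → ℂ) (h4 : ℤ → ℂ)
    (hζ0 : ζ 0 = 0) (hh4neg : h4 (-1) = 0)
    (hi : ∀ m n : ℕ, Ba (p (2 * m)) (p (2 * n + 1) - ζ n • p (2 * n - 1))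
        = if n = m then h1 n else 0)
    (hii : ∀ m n : ℕ, Ba (p (2 * m)) (p (2 * n)) = 0)
    (hii' : ∀ m n : ℕ,
      Ba (p (2 * n + 1) - ζ n • p (2 * n - 1)) (p (2 * m + 1) - ζ m • p (2 * m - 1)) = 0)
    (hiii : ∀ m n : ℕ, Bb (p (2 * m)) (p (2 * n + 1))
        = (if n = m then h4 (2 * n) else 0)
          - (if (m : ℤ) - 1 = (n : ℤ) then h4 (2 * m - 1) else 0))
    (hiv : ∀ m n : ℕ, Bb (p (2 * m)) (p (2 * n)) = 0)
    (hiv' : ∀ m n : ℕ, Bb (p (2 * m + 1)) (p (2 * n + 1)) = 0)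
    (α ξ : ℤ → ℂ)
    (hα : ∀ j : ℕ, h4 (2 * j + 1) * α (j + 1)
        - (X ^ 2 * h1 j + h4 (2 * j) + ζ j * h4 (2 * j - 1)) * α j
        + ζ j * h4 (2 * j - 2) * α ((j : ℤ) - 1) = 0)
    (hξ : ∀ j : ℕ, ζ (j + 1) * h4 (2 * j) * ξ (j + 1)
        - (X ^ 2 * h1 j + h4 (2 * j) + ζ j * h4 (2 * j - 1)) * ξ j
        + h4 (2 * j - 1) * ξ ((j : ℤ) - 1) = 0)
    (hαneg : α (-1) = 0) (hξneg : ξ (-1) = 0)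
    (hα0 : α 0 = 1) (hξ0 : ξ 0 = 1)
    (hαne : ∀ m : ℕ, α m ≠ 0) (hξne : ∀ m : ℕ, ξ m ≠ 0)
    (Q : ℕ → Polynomial ℂ)
    (hQe : ∀ m : ℕ, Q (2 * m) = (α m)⁻¹ • ∑ k ∈ Finset.range (m + 1), α k • p (2 * k))
    (hQo : ∀ m : ℕ, Q (2 * m + 1)
        = (ξ m)⁻¹ • ∑ k ∈ Finset.range (m + 1), ξ k • (p (2 * k + 1) - ζ k • p (2 * k - 1))) :
    (∀ n : ℕ,
      X ^ 2 * Ba (Q (2 * n)) (Q (2 * n + 1)) + Bb (Q (2 * n)) (Q (2 * n + 1))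
        = h4 (2 * n + 1) * α (n + 1) / α n) ∧
    (∀ N : ℕ, 1 ≤ N →
      ∏ j ∈ Finset.range N,
        (X ^ 2 * Ba (Q (2 * j)) (Q (2 * j + 1)) + Bb (Q (2 * j)) (Q (2 * j + 1)))
      = α N * ∏ j ∈ Finset.range N, h4 (2 * j + 1)) := by
  -- pairing of the even polynomials with the combinations `p_{2k+1} - ζ_k p_{2k-1}`
  have hb : ∀ m k : ℕ, Bb (p (2 * m)) (p (2 * k + 1) - ζ k • p (2 * k - 1))
      = (if k = m then h4 (2 * k) + ζ k * h4 (2 * k - 1) else 0)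
        - (if k + 1 = m then h4 (2 * k + 1) else 0)
        - (if k = m + 1 then ζ k * h4 (2 * k - 2) else 0) := by
    intro m k
    have h₁ : (if (m : ℤ) - 1 = (k : ℤ) then h4 (2 * m - 1) else 0)
        = if k + 1 = m then h4 (2 * k + 1) else 0 := by
      by_cases h : k + 1 = m
      · subst h
        rw [if_pos (by push_cast; ring), if_pos rfl]
        congr 1
        push_cast
        ring
      · rw [if_neg (by omega), if_neg h]
    rw [map_sub, map_smul, hiii, h₁, smul_eq_mul]
    rcases k with _ | l
    · simp [hζ0]
    · have h₂ : (2 * ((l + 1 : ℕ) : ℤ) - 1) = 2 * (l : ℤ) + 1 := by push_cast; ring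
      have h₃ : (2 * ((l + 1 : ℕ) : ℤ) - 2) = 2 * (l : ℤ) := by push_cast; ring
      have h₄ : (if (m : ℤ) - 1 = (l : ℤ) then h4 (2 * m - 1) else 0)
          = if l + 1 = m then h4 (2 * l + 1) else 0 := by
        by_cases h : l + 1 = m
        · subst h
          rw [if_pos (by push_cast; ring), if_pos rfl, h₂]
        · rw [if_neg (by omega), if_neg h]
      rw [h₂, h₃, hiii, h₄]
      simp only [Nat.add_right_cancel_iff]
      split_ifs <;> ring
  have hpair : ∀ m k : ℕ, α m * (X ^ 2 * Ba (p (2 * m)) (p (2 * k + 1) - ζ k • p (2 * k - 1))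
        + Bb (p (2 * m)) (p (2 * k + 1) - ζ k • p (2 * k - 1)))
      = (if m = k then h4 (2 * k + 1) * α (k + 1) + ζ k * h4 (2 * k - 2) * α ((k : ℤ) - 1) else 0)
        - (if m = k + 1 then h4 (2 * k + 1) * α (k + 1) else 0)
        - (if m + 1 = k then ζ k * h4 (2 * k - 2) * α ((k : ℤ) - 1) else 0) := by
    intro m k
    rw [hi, hb]
    rcases lt_trichotomy m k with h | rfl | h
    · by_cases h' : m + 1 = k
      · subst h'
        simp [show m + 1 + 1 ≠ m by omega, show m ≠ m + 1 + 1 by omega]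
        ring
      · simp [h.ne, h.ne', h', Ne.symm h', show m ≠ k + 1 by omega, show k + 1 ≠ m by omega]
    · simp
      linear_combination -hα m
    · by_cases h' : m = k + 1
      · subst h'
        simp [show k + 1 + 1 ≠ k by omega, show k ≠ k + 1 + 1 by omega]
        ring
      · simp [h.ne, h.ne', h', Ne.symm h', show m + 1 ≠ k by omega, show k ≠ m + 1 by omega]
  have hcol : ∀ n k : ℕ, k ≤ n → ∑ m ∈ Finset.range (n + 1), α m *
        (X ^ 2 * Ba (p (2 * m)) (p (2 * k + 1) - ζ k • p (2 * k - 1))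
          + Bb (p (2 * m)) (p (2 * k + 1) - ζ k • p (2 * k - 1)))
      = if k = n then h4 (2 * n + 1) * α (n + 1) else 0 := by
    intro n k hk
    have hlow : ∑ m ∈ Finset.range (n + 1),
        (if m + 1 = k then ζ k * h4 (2 * k - 2) * α ((k : ℤ) - 1) else 0)
          = ζ k * h4 (2 * k - 2) * α ((k : ℤ) - 1) := by
      rcases k with _ | l
      · simp [hζ0]
      · simp only [Nat.add_right_cancel_iff, Finset.sum_ite_eq', Finset.mem_range]
        rw [if_pos (by omega)]
    simp only [hpair, Finset.sum_sub_distrib, hlow, Finset.sum_ite_eq', Finset.mem_range]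
    rw [if_pos (by omega)]
    rcases hk.eq_or_lt with rfl | h
    · simp
    · rw [if_pos (by omega), if_neg h.ne]
      ring
  have hnorm : ∀ n : ℕ,
      X ^ 2 * Ba (Q (2 * n)) (Q (2 * n + 1)) + Bb (Q (2 * n)) (Q (2 * n + 1))
        = h4 (2 * n + 1) * α (n + 1) / α n := by
    intro n
    have hexp : X ^ 2 * Ba (Q (2 * n)) (Q (2 * n + 1)) + Bb (Q (2 * n)) (Q (2 * n + 1))
        = (α n)⁻¹ * ((ξ n)⁻¹ * ∑ k ∈ Finset.range (n + 1), ξ k *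
          ∑ m ∈ Finset.range (n + 1), α m *
            (X ^ 2 * Ba (p (2 * m)) (p (2 * k + 1) - ζ k • p (2 * k - 1))
              + Bb (p (2 * m)) (p (2 * k + 1) - ζ k • p (2 * k - 1)))) := by
      rw [hQe, hQo]
      generalize hR : (fun k : ℕ => p (2 * k + 1) - ζ k • p (2 * k - 1)) = R
      have hR' : ∀ k : ℕ, p (2 * k + 1) - ζ k • p (2 * k - 1) = R k := fun k => by rw [← hR]
      simp only [hR', map_smul, map_sum, LinearMap.smul_apply, LinearMap.sum_apply, smul_eq_mul,
        Finset.mul_sum, mul_add, Finset.sum_add_distrib]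
      congr 1 <;>
        exact Finset.sum_congr rfl fun _ _ => Finset.sum_congr rfl fun _ _ => by ring
    have hsum : ∑ k ∈ Finset.range (n + 1), ξ k * ∑ m ∈ Finset.range (n + 1), α m *
            (X ^ 2 * Ba (p (2 * m)) (p (2 * k + 1) - ζ k • p (2 * k - 1))
              + Bb (p (2 * m)) (p (2 * k + 1) - ζ k • p (2 * k - 1)))
        = ξ n * (h4 (2 * n + 1) * α (n + 1)) := by
      rw [Finset.sum_congr rfl fun k hk => by
        rw [hcol n k (Nat.lt_succ_iff.mp (Finset.mem_range.mp hk))]]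
      simp
    rw [hexp, hsum, inv_mul_cancel_left₀ (hξne n), inv_mul_eq_div]
  refine ⟨hnorm, fun N _ => ?_⟩
  simp only [hnorm]
  clear * - hα0 hαne
  induction N with
  | zero => simp [hα0]
  | succ N ih =>
    rw [Finset.prod_range_succ, ih, Finset.prod_range_succ]
    have := hαne N
    push_cast
    field_simp
end

section
/- Let I ⊆ ℝ be an interval, V : I → ℝ measurable with ∫_I |x|^k e^{−2V(x)} dx < ∞ for every integer k ≥ 0, and let {p_n}_{n≥0} be monic polynomials with deg p_n = n (p_{−1} := 0) satisfying ∫_I p_n(x) p_m(x) e^{−2V(x)} dx = h_n δ_{n,m}. Suppose there is a real polynomial f and scalar sequences {a_n}, {b_n}, {c_n} such that f(z) p_n'(z) = a_n p_{n+1}(z) + b_n p_n(z) + c_n p_{n−1}(z) for all n ≥ 0. Define ⟨φ,ψ⟩_4 := (1/2) ∫_I (φ(z)ψ'(z) − φ'(z)ψ(z)) f(z) e^{−2V(z)} dz. Then for all m,n ≥ 0: ⟨p_{2m}, p_{2n}⟩_4 = 0, ⟨p_{2m+1}, p_{2n+1}⟩_4 = 0, and ⟨p_{2m}, p_{2n+1}⟩_4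 = h4_{2n} δ_{n,m} − h4_{2m−1} δ_{m−1,n}, where h4_j := (1/2)(c_{j+1} h_j − a_j h_{j+1}). -/
open MeasureTheory Polynomial

theorem integrableOn_eval_mul_of_moments {I : Set ℝ} {w : ℝ → ℝ} (hw : Measurable w)
    (hmom : ∀ k : ℕ, IntegrableOn (fun x : ℝ => |x| ^ k * w x) I) (q : ℝ[X]) :
    IntegrableOn (fun x => q.eval x * w x) I := by
  induction q using Polynomial.induction_on' with
  | add q r hq hr =>
    simp only [eval_add, add_mul]
    exact Integrable.add hq hr
  | monomial k s =>
    refine ((hmom k).const_mul s).mono (by fun_prop) (Filter.Eventually.of_forall fun x => ?_)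
    simp [mul_assoc]

theorem integral_orthogonal_mul_expansion {I : Set ℝ} {w : ℝ → ℝ} (hw : Measurable w)
    (hmom : ∀ k : ℕ, IntegrableOn (fun x : ℝ => |x| ^ k * w x) I)
    {p : ℤ → ℝ[X]} (hpneg : p (-1) = 0) {h : ℕ → ℝ}
    (horth : ∀ n m : ℕ, ∫ x in I, (p n).eval x * (p m).eval x * w x = if n = m then h n else 0)
    (r s t : ℝ) (M N : ℕ) :
    ∫ x in I, (p M * (r • p (N + 1) + s • p N + t • p ((N : ℤ) - 1))).eval x * w x
      = (if M = N + 1 then r * h M else 0) + (if M = N then s * h M else 0)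
        + (if M + 1 = N then t * h M else 0) := by
  have hint := integrableOn_eval_mul_of_moments hw hmom
  have hprev : ∫ x in I, (p M * p ((N : ℤ) - 1)).eval x * w x = if M + 1 = N then h M else 0 := by
    cases N with
    | zero => simp [hpneg]
    | succ N => simpa using horth M N
  have hnext : ∫ x in I, (p M * p (N + 1)).eval x * w x = if M = N + 1 then h M else 0 := by
    simpa using horth M (N + 1)
  have hself : ∫ x in I, (p M * p N).eval x * w x = if M = N then h M else 0 := by
    simpa using horth M N
  have hexp : ∀ x, (p M * (r • p (N + 1) + s • p N + t • p ((N : ℤ) - 1))).eval x * w x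
      = r * ((p M * p (N + 1)).eval x * w x) + s * ((p M * p N).eval x * w x)
        + t * ((p M * p ((N : ℤ) - 1)).eval x * w x) := fun x => by
    simp only [eval_mul, eval_add, eval_smul, smul_eq_mul]
    ring
  simp_rw [hexp]
  rw [integral_add (by exact ((hint _).const_mul r).add ((hint _).const_mul s))
      ((hint _).const_mul t),
    integral_add ((hint _).const_mul r) ((hint _).const_mul s)]
  simp only [integral_const_mul, hprev, hnext, hself, mul_ite, mul_zero]

theorem integral_wronskian_orthogonal {I : Set ℝ} {w : ℝ → ℝ} (hw : Measurable w)
    (hmom : ∀ k : ℕ, IntegrableOn (fun x : ℝ => |x| ^ k * w x) I)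
    {p : ℤ → ℝ[X]} (hpneg : p (-1) = 0) {h : ℕ → ℝ}
    (horth : ∀ n m : ℕ, ∫ x in I, (p n).eval x * (p m).eval x * w x = if n = m then h n else 0)
    {f : ℝ[X]} {a b c : ℕ → ℝ}
    (hrec : ∀ n : ℕ, f * derivative (p n)
        = a n • p (n + 1) + b n • p n + c n • p ((n : ℤ) - 1)) (M N : ℕ) :
    ∫ z in I, ((p M).eval z * (derivative (p N)).eval z
        - (derivative (p M)).eval z * (p N).eval z) * f.eval z * w z
      = (if M + 1 = N then c N * h M - a M * h N else 0)
        - (if N + 1 = M then c M * h N - a N * h M else 0) := by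
  have hint := integrableOn_eval_mul_of_moments hw hmom
  have hsplit : ∀ z, ((p M).eval z * (derivative (p N)).eval z
        - (derivative (p M)).eval z * (p N).eval z) * f.eval z * w z
      = (p M * (f * derivative (p N))).eval z * w z
        - (p N * (f * derivative (p M))).eval z * w z := fun z => by
    simp only [eval_mul]
    ring
  simp_rw [hsplit]
  rw [integral_sub (hint _) (hint _), hrec, hrec,
    integral_orthogonal_mul_expansion hw hmom hpneg horth,
    integral_orthogonal_mul_expansion hw hmom hpneg horth]
  grind

/-- **Proposition 4 (β = 4 structure for classical weights)**: if the monic orthogonal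
polynomials `p_n` for the weight `e^{-2V}` on an interval `I` satisfy
`f p_n' = a_n p_{n+1} + b_n p_n + c_n p_{n-1}`, then the β = 4 skew inner product with
weight `f e^{-2V}` pairs them as
`⟨p_{2m}, p_{2n+1}⟩_4 = h4_{2n} δ_{n,m} - h4_{2m-1} δ_{m-1,n}` with
`h4_j = (c_{j+1} h_j - a_j h_{j+1})/2`, and vanishes on equal parities. -/
theorem statement4 (I : Set ℝ) (hI : I.OrdConnected) (hIm : MeasurableSet I)
    (V : ℝ → ℝ) (hV : Measurable V)
    (hmom : ∀ k : ℕ, IntegrableOn (fun x : ℝ => |x| ^ k * Real.exp (-2 * V x)) I)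
    (p : ℤ → Polynomial ℝ) (hpneg : p (-1) = 0)
    (hmonic : ∀ n : ℕ, (p n).Monic) (hdeg : ∀ n : ℕ, (p n).natDegree = n)
    (h : ℕ → ℝ)
    (horth : ∀ n m : ℕ,
      ∫ x in I, (p n).eval x * (p m).eval x * Real.exp (-2 * V x)
        = if n = m then h n else 0)
    (f : Polynomial ℝ) (a b c : ℕ → ℝ)
    (hrec : ∀ n : ℕ, f * Polynomial.derivative (p n)
        = a n • p (n + 1) + b n • p n + c n • p ((n : ℤ) - 1)) :
    ∀ m n : ℕ,
      ((1 / 2 : ℝ) * ∫ z in I,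
          ((p (2 * m)).eval z * (Polynomial.derivative (p (2 * n + 1))).eval z
            - (Polynomial.derivative (p (2 * m))).eval z * (p (2 * n + 1)).eval z)
          * f.eval z * Real.exp (-2 * V z)
        = (if n = m then (c (2 * n + 1) * h (2 * n) - a (2 * n) * h (2 * n + 1)) / 2 else 0)
          - (if (m : ℤ) - 1 = (n : ℤ) then
              (c (2 * n + 2) * h (2 * n + 1) - a (2 * n + 1) * h (2 * n + 2)) / 2 else 0)) ∧
      ((1 / 2 : ℝ) * ∫ z in I,
          ((p (2 * m)).eval z * (Polynomial.derivative (p (2 * n))).eval z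
            - (Polynomial.derivative (p (2 * m))).eval z * (p (2 * n)).eval z)
          * f.eval z * Real.exp (-2 * V z) = 0) ∧
      ((1 / 2 : ℝ) * ∫ z in I,
          ((p (2 * m + 1)).eval z * (Polynomial.derivative (p (2 * n + 1))).eval z
            - (Polynomial.derivative (p (2 * m + 1))).eval z * (p (2 * n + 1)).eval z)
          * f.eval z * Real.exp (-2 * V z) = 0) := by
  have hw : Measurable fun x => Real.exp (-2 * V x) := by fun_prop
  have key := integral_wronskian_orthogonal hw hmom hpneg horth hrec
  intro m n
  have hmixed := key (2 * m) (2 * n + 1)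
  have heven := key (2 * m) (2 * n)
  have hodd := key (2 * m + 1) (2 * n + 1)
  push_cast at hmixed heven hodd
  rw [hmixed, heven, hodd]
  refine ⟨?_, ?_, ?_⟩
  · rcases eq_or_ne n m with rfl | hnm
    · rw [if_pos rfl, if_neg (by lia), if_pos rfl, if_neg (by lia)]
      ring
    · rcases eq_or_ne m (n + 1) with rfl | hmn
      · simp [mul_add]
        ring
      · rw [if_neg (by lia), if_neg (by lia), if_neg hnm, if_neg (by lia)]
        simp
  · rw [if_neg (by lia), if_neg (by lia)]
    simp
  · rw [if_neg (by lia), if_neg (by lia)]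
    simp
end

section
/- Let {p_k}_{k≥0} be the monic Hermite polynomials, i.e. p_k is monic of degree k and ∫_ℝ p_j(x) p_k(x) e^{−x²} dx = 0 for j ≠ k (with p_{−1} := 0). Then for all integers m, n ≥ 0, (1/2) ∫_ℝ ∫_ℝ p_{2m}(y) (p_{2n+1}(z) − n p_{2n−1}(z)) sgn(z−y) e^{−y²/2} e^{−z²/2} dy dz = 2^{−2n} √π Γ(2n+1) δ_{n,m}. -/
open MeasureTheory Polynomial

/-- A polynomial times a Gaussian is integrable. -/
lemma Polynomial.integrable_eval_mul_exp_neg_mul_sq (f : ℝ[X]) {b : ℝ} (hb : 0 < b) :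
    Integrable fun x : ℝ => f.eval x * Real.exp (-b * x ^ 2) := by
  induction f using Polynomial.induction_on' with
  | add f g hf hg =>
    simp only [eval_add, add_mul]
    exact hf.add hg
  | monomial n a =>
    have h := (integrable_rpow_mul_exp_neg_mul_sq hb (s := n)
      (by have : (0 : ℝ) ≤ n := n.cast_nonneg; linarith)).const_mul a
    simpa [mul_assoc] using h

/-- The derivative of a polynomial times a Gaussian. -/
lemma Polynomial.hasDerivAt_eval_mul_exp_neg_mul_sq (f : ℝ[X]) (b x : ℝ) :
    HasDerivAt (fun x : ℝ => f.eval x * Real.exp (-b * x ^ 2))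
      ((derivative f - C (2 * b) * X * f).eval x * Real.exp (-b * x ^ 2)) x := by
  have h := (f.hasDerivAt x).mul (((hasDerivAt_pow 2 x).const_mul (-b)).exp)
  refine h.congr_deriv ?_
  simp
  ring

/-- Integration against the Gaussian weight `exp (-x ^ 2)`, as a linear functional on
polynomials. -/
noncomputable def gaussianFunctional : ℝ[X] →ₗ[ℝ] ℝ where
  toFun f := ∫ x : ℝ, f.eval x * Real.exp (-1 * x ^ 2)
  map_add' f g := by
    simp only [eval_add, add_mul]
    exact integral_add (f.integrable_eval_mul_exp_neg_mul_sq one_pos)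
      (g.integrable_eval_mul_exp_neg_mul_sq one_pos)
  map_smul' c f := by
    simp [mul_assoc, integral_const_mul]

lemma gaussianFunctional_apply (f : ℝ[X]) :
    gaussianFunctional f = ∫ x : ℝ, f.eval x * Real.exp (-x ^ 2) := by
  simp [gaussianFunctional]

lemma gaussianFunctional_C (a : ℝ) : gaussianFunctional (C a) = a * Real.sqrt Real.pi := by
  have h := integral_gaussian 1
  rw [div_one] at h
  simp only [gaussianFunctional, LinearMap.coe_mk, AddHom.coe_mk, eval_C, integral_const_mul, h]

/-- Integration by parts against the Gaussian weight. -/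
lemma gaussianFunctional_derivative (f : ℝ[X]) :
    gaussianFunctional (derivative f) = 2 * gaussianFunctional (X * f) := by
  have h : gaussianFunctional (derivative f - C (2 * 1) * X * f) = 0 :=
    integral_eq_zero_of_hasDerivAt_of_integrable
      (fun x => f.hasDerivAt_eval_mul_exp_neg_mul_sq 1 x)
      (Polynomial.integrable_eval_mul_exp_neg_mul_sq _ one_pos)
      (f.integrable_eval_mul_exp_neg_mul_sq one_pos)
  rw [mul_one, mul_assoc, ← smul_eq_C_mul, map_sub, map_smul, smul_eq_mul] at h
  linarith

/-- The monic Hermite polynomials for the weight `exp (-x ^ 2)`. -/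
noncomputable def monicHermite : ℕ → ℝ[X]
  | 0 => 1
  | k + 1 => X * monicHermite k - C (1 / 2) * derivative (monicHermite k)

lemma monicHermite_succ (k : ℕ) :
    monicHermite (k + 1) = X * monicHermite k - C (1 / 2) * derivative (monicHermite k) := rfl

lemma derivative_monicHermite_succ (k : ℕ) :
    derivative (monicHermite (k + 1)) = C ((k : ℝ) + 1) * monicHermite k := by
  induction k with
  | zero => simp [monicHermite]
  | succ k ih =>
    rw [monicHermite_succ (k + 1), derivative_sub, derivative_mul, derivative_C_mul, derivative_X,
      ih, derivative_C_mul, monicHermite_succ k]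
    simp only [Nat.cast_succ, map_add, map_one]
    ring

lemma monicHermite_natDegree_le_and_coeff (k : ℕ) :
    (monicHermite k).natDegree ≤ k ∧ (monicHermite k).coeff k = 1 := by
  induction k with
  | zero => simp [monicHermite]
  | succ k ih =>
    obtain ⟨h1, h2⟩ := ih
    have h3 : (derivative (monicHermite k)).natDegree ≤ k :=
      (natDegree_derivative_le _).trans (by omega)
    constructor
    · rw [monicHermite_succ]
      refine (natDegree_sub_le _ _).trans
        (max_le ?_ ((natDegree_C_mul_le _ _).trans (by omega)))
      exact natDegree_mul_le.trans (by rw [natDegree_X]; omega)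
    · rw [monicHermite_succ, coeff_sub, coeff_X_mul, coeff_C_mul,
        coeff_eq_zero_of_natDegree_lt (by omega : (derivative (monicHermite k)).natDegree < k + 1),
        h2]
      simp

/-- Rodrigues' formula, in weak form. -/
lemma gaussianFunctional_monicHermite_mul (k : ℕ) (f : ℝ[X]) :
    gaussianFunctional (monicHermite k * f) =
      (1 / 2) ^ k * gaussianFunctional (derivative^[k] f) := by
  induction k generalizing f with
  | zero => simp [monicHermite]
  | succ k ih =>
    have h := gaussianFunctional_derivative (monicHermite k * f)
    rw [derivative_mul, map_add, ih (derivative f)] at h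
    have e : monicHermite (k + 1) * f =
        X * (monicHermite k * f) - (1 / 2 : ℝ) • (derivative (monicHermite k) * f) := by
      rw [monicHermite_succ, smul_eq_C_mul]; ring
    rw [e, map_sub, map_smul, smul_eq_mul, Function.iterate_succ_apply, pow_succ]
    linarith

lemma gaussianFunctional_monicHermite_mul_of_natDegree_le {k : ℕ} {f : ℝ[X]}
    (hf : f.natDegree ≤ k) :
    gaussianFunctional (monicHermite k * f) =
      (1 / 2) ^ k * (k.factorial * f.coeff k * Real.sqrt Real.pi) := by
  have h0 : derivative^[k] f = C (k.factorial * f.coeff k) := by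
    have h1 : (derivative^[k] f).natDegree = 0 := by
      have := natDegree_iterate_derivative f k
      omega
    rw [eq_C_of_natDegree_eq_zero h1, coeff_iterate_derivative]
    simp [Nat.descFactorial_self]
  rw [gaussianFunctional_monicHermite_mul, h0, gaussianFunctional_C]

/-- Orthogonality characterises the monic Hermite polynomials. -/
lemma eq_monicHermite_of_orthogonal {p : ℕ → ℝ[X]} (hmonic : ∀ k, (p k).Monic)
    (hdeg : ∀ k, (p k).natDegree = k)
    (horth : ∀ j k, j ≠ k → gaussianFunctional (p j * p k) = 0) (k : ℕ) :
    p k = monicHermite k := by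
  induction k using Nat.strong_induction_on with
  | _ k ih =>
    by_contra hne
    have hd : p k - monicHermite k ≠ 0 := sub_ne_zero.mpr hne
    obtain ⟨hle, hco⟩ := monicHermite_natDegree_le_and_coeff k
    have hdk : (p k - monicHermite k).natDegree ≤ k :=
      (natDegree_sub_le _ _).trans (max_le (hdeg k).le hle)
    have hpk : (p k).coeff k = 1 := by
      have := (hmonic k).coeff_natDegree
      rwa [hdeg k] at this
    have hlt : (p k - monicHermite k).natDegree < k := by
      refine lt_of_le_of_ne hdk fun h => hd ?_
      rw [← leadingCoeff_eq_zero, leadingCoeff, h, coeff_sub, hpk, hco, sub_self]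
    have h1 := gaussianFunctional_monicHermite_mul_of_natDegree_le
      (le_refl (p k - monicHermite k).natDegree)
    set j := (p k - monicHermite k).natDegree with hj
    have hjle := (monicHermite_natDegree_le_and_coeff j).1
    have h2 : gaussianFunctional (monicHermite k * monicHermite j) = 0 := by
      rw [gaussianFunctional_monicHermite_mul_of_natDegree_le (hjle.trans hlt.le),
        coeff_eq_zero_of_natDegree_lt (hjle.trans_lt hlt)]
      simp
    rw [mul_sub, map_sub, mul_comm _ (monicHermite k), h2, ← ih j hlt, horth j k hlt.ne,
      sub_zero] at h1
    have hc : (p k - monicHermite k).coeff j ≠ 0 := by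
      rw [hj, coeff_natDegree]
      exact leadingCoeff_ne_zero.mpr hd
    have hpi : Real.sqrt Real.pi ≠ 0 := (Real.sqrt_pos.mpr Real.pi_pos).ne'
    have : (1 / 2 : ℝ) ^ j * (j.factorial * (p k - monicHermite k).coeff j * Real.sqrt Real.pi)
        ≠ 0 := by
      have := j.factorial_ne_zero
      positivity
    exact this h1.symm

/-- Integrating a derivative against `sgn (z - y)`. -/
lemma integral_deriv_mul_sign {F F' : ℝ → ℝ} (hF : ∀ x, HasDerivAt F (F' x) x)
    (hi : Integrable F) (hi' : Integrable F') (y : ℝ) :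
    ∫ z : ℝ, F' z * Real.sign (z - y) = -2 * F y := by
  have htop := tendsto_zero_of_hasDerivAt_of_integrableOn_Ioi (a := y)
    (fun x _ => hF x) hi'.integrableOn hi.integrableOn
  have hbot := tendsto_zero_of_hasDerivAt_of_integrableOn_Iic (a := y)
    (fun x _ => hF x) hi'.integrableOn hi.integrableOn
  have h1 := integral_Ioi_of_hasDerivAt_of_tendsto' (a := y) (fun x _ => hF x)
    hi'.integrableOn htop
  have h2 := integral_Iic_of_hasDerivAt_of_tendsto' (a := y) (fun x _ => hF x)
    hi'.integrableOn hbot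
  have e1 : Set.EqOn (fun z => F' z * Real.sign (z - y)) F' (Set.Ioi y) := fun z hz => by
    simp [Real.sign_of_pos (sub_pos.mpr hz)]
  have e2 : Set.EqOn (fun z => F' z * Real.sign (z - y)) (fun z => -F' z) (Set.Iio y) :=
    fun z hz => by simp [Real.sign_of_neg (sub_neg.mpr hz)]
  have i1 : IntegrableOn (fun z => F' z * Real.sign (z - y)) (Set.Ioi y) :=
    hi'.integrableOn.congr_fun e1.symm measurableSet_Ioi
  have i2 : IntegrableOn (fun z => F' z * Real.sign (z - y)) (Set.Iic y) := by
    rw [integrableOn_Iic_iff_integrableOn_Iio]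
    exact hi'.neg.integrableOn.congr_fun e2.symm measurableSet_Iio
  rw [← intervalIntegral.integral_Iic_add_Ioi i2 i1, setIntegral_congr_fun measurableSet_Ioi e1,
    h1, integral_Iic_eq_integral_Iio, setIntegral_congr_fun measurableSet_Iio e2, integral_neg,
    ← integral_Iic_eq_integral_Iio, h2]
  ring

/-- The skew inner product with weight `exp (-x ^ 2 / 2)`, against `X * f - f'`. -/
lemma integral_integral_sign_eq_gaussianFunctional (f g : ℝ[X]) :
    ∫ y : ℝ, ∫ z : ℝ, g.eval y * (X * f - derivative f).eval z * Real.sign (z - y)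
      * Real.exp (-y ^ 2 / 2) * Real.exp (-z ^ 2 / 2) = 2 * gaussianFunctional (g * f) := by
  have hb : (0 : ℝ) < 1 / 2 := by norm_num
  have key : ∀ y : ℝ, ∫ z : ℝ, g.eval y * (X * f - derivative f).eval z * Real.sign (z - y)
      * Real.exp (-y ^ 2 / 2) * Real.exp (-z ^ 2 / 2)
      = 2 * ((g * f).eval y * Real.exp (-y ^ 2)) := by
    intro y
    have h := integral_deriv_mul_sign (fun x => f.hasDerivAt_eval_mul_exp_neg_mul_sq (1 / 2) x)
      (f.integrable_eval_mul_exp_neg_mul_sq hb)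
      (Polynomial.integrable_eval_mul_exp_neg_mul_sq _ hb) y
    have e : Real.exp (-y ^ 2) = Real.exp (-y ^ 2 / 2) * Real.exp (-(1 / 2) * y ^ 2) := by
      rw [← Real.exp_add]; congr 1; ring
    calc _ = ∫ z : ℝ, (-(g.eval y * Real.exp (-y ^ 2 / 2))) *
          ((derivative f - C (2 * (1 / 2)) * X * f).eval z * Real.exp (-(1 / 2) * z ^ 2)
            * Real.sign (z - y)) := by
          refine integral_congr_ae (Filter.Eventually.of_forall fun z => ?_)
          have : -z ^ 2 / 2 = -(1 / 2) * z ^ 2 := by ring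
          simp only [this, eval_sub, eval_mul, eval_X, eval_C]
          ring
      _ = _ := by
          rw [integral_const_mul, h, e, eval_mul]
          ring
  simp_rw [key, integral_const_mul, gaussianFunctional_apply]

/-- **Gaussian case, β = 1 pairing**: for the monic Hermite polynomials `p_k`,
`⟨p_{2m}, p_{2n+1} - n p_{2n-1}⟩_{1} = 2^{-2n} √π Γ(2n+1) δ_{n,m}`, where the β = 1 skew
inner product has one-body weight `e^{-x²/2}` on `ℝ`. -/
theorem statement5
    (p : ℤ → Polynomial ℝ) (hpneg : p (-1) = 0)
    (hmonic : ∀ k : ℕ, (p k).Monic) (hdeg : ∀ k : ℕ, (p k).natDegree = k)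
    (horth : ∀ j k : ℕ, j ≠ k →
      ∫ x : ℝ, (p j).eval x * (p k).eval x * Real.exp (-x ^ 2) = 0) :
    ∀ m n : ℕ,
      (1 / 2 : ℝ) * ∫ y : ℝ, ∫ z : ℝ,
          (p (2 * m)).eval y * ((p (2 * n + 1)).eval z - (n : ℝ) * (p (2 * n - 1)).eval z)
            * Real.sign (z - y) * Real.exp (-y ^ 2 / 2) * Real.exp (-z ^ 2 / 2)
        = if n = m then
            (2 : ℝ) ^ (-(2 * (n : ℤ))) * Real.sqrt Real.pi * Real.Gamma (2 * n + 1)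
          else 0 := by
  have hL : ∀ j k : ℕ, j ≠ k → gaussianFunctional (p j * p k) = 0 := fun j k hjk => by
    rw [gaussianFunctional_apply, ← horth j k hjk]
    simp only [eval_mul]
  have hp : ∀ k : ℕ, p k = monicHermite k :=
    eq_monicHermite_of_orthogonal (p := fun k : ℕ => p k) hmonic hdeg hL
  intro m n
  have hm : p (2 * m) = p ((2 * m : ℕ) : ℤ) := by push_cast; rfl
  have hq : p (2 * n + 1) - C (n : ℝ) * p (2 * n - 1)
      = X * p ((2 * n : ℕ) : ℤ) - derivative (p ((2 * n : ℕ) : ℤ)) := by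
    have h1 : p (2 * n + 1) = p ((2 * n + 1 : ℕ) : ℤ) := by push_cast; rfl
    rw [h1, hp, hp, monicHermite_succ]
    cases n with
    | zero => simp [monicHermite]
    | succ n =>
      have h2 : p (2 * ((n + 1 : ℕ) : ℤ) - 1) = p ((2 * n + 1 : ℕ) : ℤ) := by
        congr 1; push_cast; ring
      have h3 : C ((n + 1 : ℕ) : ℝ) * monicHermite (2 * n + 1)
          = C (1 / 2) * derivative (monicHermite (2 * (n + 1))) := by
        rw [show 2 * (n + 1) = 2 * n + 1 + 1 by ring, derivative_monicHermite_succ, ← mul_assoc,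
          ← C_mul]
        congr 2
        push_cast
        ring
      have h4 : (C (1 / 2 : ℝ) : ℝ[X]) + C (1 / 2) = 1 := by
        rw [← C_add]; norm_num
      rw [h2, hp, h3]
      linear_combination (-derivative (monicHermite (2 * (n + 1)))) * h4
  have hint := integral_integral_sign_eq_gaussianFunctional (p ((2 * n : ℕ) : ℤ)) (p (2 * m))
  rw [← hq] at hint
  simp only [eval_sub, eval_mul, eval_C] at hint
  rw [hint, hm]
  split_ifs with h
  · subst h
    obtain ⟨hle, hco⟩ := monicHermite_natDegree_le_and_coeff (2 * n)
    rw [hp, gaussianFunctional_monicHermite_mul_of_natDegree_le hle, hco,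
      show (2 * (n : ℝ) + 1) = ((2 * n : ℕ) : ℝ) + 1 by push_cast; rfl, Real.Gamma_nat_eq_factorial,
      zpow_neg, show (2 * (n : ℤ)) = ((2 * n : ℕ) : ℤ) by push_cast; rfl, zpow_natCast, one_div,
      inv_pow]
    ring
  · rw [hL _ _ (by omega), mul_zero, mul_zero]
end

section
/- Fix X ∈ ℝ. Let {α_j}_{j≥−1} be the real sequence determined by α_{−1} = 0, α_0 = 1 and the three-term recurrence (2j+2)(2j+1) α_{j+1} − 2(2X² + 4j + 1) α_j + 4 α_{j−1} = 0 for all j ≥ 0. Then for every j ≥ 0, α_j = 2^{2j} (j!/(2j)!) · Σ_{k=0}^{j} [Γ(j+1/2) / (Γ(k+1/2) · k! · (j−k)!)] · X^{2k}; equivalently α_j = 2^{2j} (j!/(2j)!) L_j^{(−1/2)}(−X²), where L_j^{(−1/2)} is the Laguerre polynomial with parameter −1/2. -/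
open Finset

open Nat in
/-- Duplication formula at half-integers. -/
lemma gamma_nat_add_half_eq_factorial (k : ℕ) :
    Real.Gamma ((k : ℝ) + 1 / 2) = (2 * k)! * √Real.pi / (4 ^ k * k !) := by
  induction k with
  | zero => simp [Real.Gamma_one_half_eq, -one_div]
  | succ k ih =>
    have hk : ((k + 1 : ℕ) : ℝ) + 1 / 2 = ((k : ℝ) + 1 / 2) + 1 := by push_cast; ring
    rw [hk, Real.Gamma_add_one (by positivity), ih, show 2 * (k + 1) = 2 * k + 1 + 1 by ring,
      Nat.factorial_succ (2 * k + 1), Nat.factorial_succ (2 * k), Nat.factorial_succ k]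
    push_cast
    field_simp
    ring

/-- The coefficient of `(4 X²) ^ k` in `α_j`, extended by zero to `k > j`. -/
noncomputable def laguerreHalfCoeff (j k : ℕ) : ℝ :=
  if k ≤ j then 1 / ((Nat.factorial (2 * k) : ℝ) * (Nat.factorial (j - k) : ℝ)) else 0

lemma laguerreHalfCoeff_of_lt {j k : ℕ} (h : j < k) : laguerreHalfCoeff j k = 0 :=
  if_neg (by omega)

lemma laguerreHalfCoeff_add (k m : ℕ) :
    laguerreHalfCoeff (k + m) k =
      1 / ((Nat.factorial (2 * k) : ℝ) * (Nat.factorial m : ℝ)) := by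
  simp [laguerreHalfCoeff]

lemma laguerreHalfCoeff_rec_zero (j : ℕ) :
    (2 * (j : ℝ) + 4) * (2 * (j : ℝ) + 3) * laguerreHalfCoeff (j + 2) 0
      - 2 * (4 * (j : ℝ) + 5) * laguerreHalfCoeff (j + 1) 0
      + 4 * laguerreHalfCoeff j 0 = 0 := by
  simp only [laguerreHalfCoeff, Nat.zero_le, if_true, Nat.sub_zero, Nat.factorial_succ]
  push_cast
  field_simp
  ring

lemma laguerreHalfCoeff_rec_succ (j k : ℕ) :
    (2 * (j : ℝ) + 4) * (2 * (j : ℝ) + 3) * laguerreHalfCoeff (j + 2) (k + 1)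
      - 2 * (4 * (j : ℝ) + 5) * laguerreHalfCoeff (j + 1) (k + 1)
      + 4 * laguerreHalfCoeff j (k + 1) = laguerreHalfCoeff (j + 1) k := by
  have hfac : Nat.factorial (2 * (k + 1)) = (2 * k + 2) * ((2 * k + 1) * Nat.factorial (2 * k)) := rfl
  rcases lt_or_ge (j + 1) k with h | h
  · simp (disch := omega) [laguerreHalfCoeff_of_lt]
  obtain ⟨m, hm⟩ := Nat.exists_eq_add_of_le h
  rcases m with _ | _ | m
  · obtain rfl : k = j + 1 := by omega
    rw [laguerreHalfCoeff_of_lt (j := j) (by omega), laguerreHalfCoeff_of_lt (j := j + 1) (by omega),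
      laguerreHalfCoeff_add (j + 1 + 1) 0, laguerreHalfCoeff_add (j + 1) 0, hfac]
    push_cast
    field_simp
    ring
  · obtain rfl : k = j := by omega
    rw [laguerreHalfCoeff_of_lt (j := k) (by omega), laguerreHalfCoeff_add (k + 1) 0,
      laguerreHalfCoeff_add (k + 1) 1, laguerreHalfCoeff_add k 1, hfac]
    push_cast [Nat.factorial]
    field_simp
    ring
  · obtain rfl : j = k + 1 + m := by omega
    rw [laguerreHalfCoeff_add (k + 1) m, add_assoc (k + 1) m 1, add_assoc (k + 1) m 2,
      laguerreHalfCoeff_add (k + 1) (m + 1), laguerreHalfCoeff_add (k + 1) (m + 2),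
      show k + 1 + (m + 1) = k + (m + 2) by ring, laguerreHalfCoeff_add k, hfac,
      Nat.factorial_succ (m + 1), Nat.factorial_succ m]
    push_cast
    field_simp
    ring

/-- The polynomial `∑ k ≤ j, y ^ k / ((2k)! (j - k)!)`. -/
noncomputable def laguerreHalfSum (y : ℝ) (j : ℕ) : ℝ :=
  ∑ k ∈ Finset.range (j + 1), laguerreHalfCoeff j k * y ^ k

lemma laguerreHalfSum_eq (y : ℝ) {j N : ℕ} (h : j < N) :
    laguerreHalfSum y j = ∑ k ∈ Finset.range N, laguerreHalfCoeff j k * y ^ k := by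
  refine Finset.sum_subset (by simpa using h) fun k _ hk => ?_
  rw [laguerreHalfCoeff_of_lt (by simpa using hk), zero_mul]

lemma laguerreHalfSum_rec (y : ℝ) (j : ℕ) :
    (2 * (j : ℝ) + 4) * (2 * (j : ℝ) + 3) * laguerreHalfSum y (j + 2)
      - (y + 2 * (4 * (j : ℝ) + 5)) * laguerreHalfSum y (j + 1)
      + 4 * laguerreHalfSum y j = 0 := by
  have key : (2 * (j : ℝ) + 4) * (2 * (j : ℝ) + 3) * laguerreHalfSum y (j + 2)
      - 2 * (4 * (j : ℝ) + 5) * laguerreHalfSum y (j + 1)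
      + 4 * laguerreHalfSum y j = y * laguerreHalfSum y (j + 1) := by
    conv_lhs => rw [laguerreHalfSum_eq y (show j + 2 < j + 2 + 1 by omega),
      laguerreHalfSum_eq y (show j + 1 < j + 2 + 1 by omega),
      laguerreHalfSum_eq y (show j < j + 2 + 1 by omega)]
    rw [laguerreHalfSum, Finset.mul_sum, Finset.mul_sum, Finset.mul_sum, Finset.mul_sum,
      ← Finset.sum_sub_distrib, ← Finset.sum_add_distrib, Finset.sum_range_succ']
    have hzero : (2 * (j : ℝ) + 4) * (2 * (j : ℝ) + 3) * (laguerreHalfCoeff (j + 2) 0 * y ^ 0)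
        - 2 * (4 * (j : ℝ) + 5) * (laguerreHalfCoeff (j + 1) 0 * y ^ 0)
        + 4 * (laguerreHalfCoeff j 0 * y ^ 0) = 0 := by
      linear_combination laguerreHalfCoeff_rec_zero j
    rw [hzero, add_zero]
    refine Finset.sum_congr rfl fun k _ => ?_
    linear_combination y ^ (k + 1) * laguerreHalfCoeff_rec_succ j k
  linear_combination key

lemma eq_laguerreHalfSum_of_rec (X : ℝ) (α : ℤ → ℝ)
    (hneg : α (-1) = 0) (h0 : α 0 = 1)
    (hrec : ∀ j : ℕ,
      (2 * (j : ℝ) + 2) * (2 * (j : ℝ) + 1) * α (j + 1)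
        - 2 * (2 * X ^ 2 + 4 * (j : ℝ) + 1) * α j + 4 * α ((j : ℤ) - 1) = 0) (j : ℕ) :
    α j = laguerreHalfSum (4 * X ^ 2) j := by
  induction j using Nat.twoStepInduction with
  | zero => simpa [laguerreHalfSum, laguerreHalfCoeff] using h0
  | one =>
    have h := hrec 0
    simp only [Nat.cast_zero, zero_sub, hneg, h0, zero_add] at h
    simp only [laguerreHalfSum, laguerreHalfCoeff, Finset.sum_range_succ, Finset.sum_range_zero]
    norm_num [Nat.factorial]
    linarith
  | more j ih ih' =>
    have h := hrec (j + 1)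
    rw [show ((j + 1 : ℕ) : ℤ) + 1 = ((j + 2 : ℕ) : ℤ) by push_cast; ring,
      show ((j + 1 : ℕ) : ℤ) - 1 = j by push_cast; ring, ih, ih'] at h
    push_cast at h ⊢
    have hpos : (2 * (j : ℝ) + 4) * (2 * (j : ℝ) + 3) ≠ 0 := by positivity
    refine mul_left_cancel₀ hpos ?_
    linear_combination h - laguerreHalfSum_rec (4 * X ^ 2) j

/-- **Gaussian case, expansion coefficients**: the solution of the recurrence
`(2j+2)(2j+1) α_{j+1} - 2(2X² + 4j + 1) α_j + 4 α_{j-1} = 0`, `α_{-1} = 0`, `α_0 = 1`,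
is `α_j = 2^{2j} (j!/(2j)!) L_j^{(-1/2)}(-X²)`, written out as the explicit sum
`α_j = 2^{2j} (j!/(2j)!) Σ_{k=0}^{j} Γ(j+1/2)/(Γ(k+1/2) k! (j-k)!) X^{2k}`. -/
theorem statement7 (X : ℝ) (α : ℤ → ℝ)
    (hneg : α (-1) = 0) (h0 : α 0 = 1)
    (hrec : ∀ j : ℕ,
      (2 * (j : ℝ) + 2) * (2 * (j : ℝ) + 1) * α (j + 1)
        - 2 * (2 * X ^ 2 + 4 * (j : ℝ) + 1) * α j + 4 * α ((j : ℤ) - 1) = 0) :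
    ∀ j : ℕ,
      α j = 2 ^ (2 * j) * (Nat.factorial j : ℝ) / (Nat.factorial (2 * j) : ℝ) *
        ∑ k ∈ Finset.range (j + 1),
          Real.Gamma ((j : ℝ) + 1 / 2)
            / (Real.Gamma ((k : ℝ) + 1 / 2) * (Nat.factorial k : ℝ)
              * (Nat.factorial (j - k) : ℝ))
            * X ^ (2 * k) := by
  intro j
  rw [eq_laguerreHalfSum_of_rec X α hneg h0 hrec, laguerreHalfSum, Finset.mul_sum]
  refine Finset.sum_congr rfl fun k hk => ?_
  have hπ : √Real.pi ≠ 0 := by positivity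
  rw [laguerreHalfCoeff, if_pos (Nat.lt_succ_iff.mp (Finset.mem_range.mp hk)),
    gamma_nat_add_half_eq_factorial, gamma_nat_add_half_eq_factorial, pow_mul, pow_mul, mul_pow]
  norm_num only
  field_simp
end

section
/- Let a > −1 and let {p_n^{(a)}}_{n≥0} be the monic Laguerre polynomials, i.e. p_n^{(a)} is monic of degree n and ∫_0^∞ p_n^{(a)}(z) p_m^{(a)}(z) z^a e^{−z} dz = 0 for n ≠ m (with p_{−1}^{(a)} := 0). Then for all integers m, n ≥ 0, (1/2) ∫_0^∞ ∫_0^∞ p_{2m}^{(a)}(y) (p_{2n+1}^{(a)}(z) − 2n(2n+a) p_{2n−1}^{(a)}(z)) sgn(z−y) · y^{(a−1)/2} e^{−y/2} · z^{(a−1)/2} e^{−z/2} dy dz = 2 Γ(2n+1) Γ(2n+a+1) δ_{n,m}. -/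
open MeasureTheory Polynomial

theorem coeff_X_mul_derivative_eq (f : ℝ[X]) (n : ℕ) :
    (X * derivative f).coeff n = n * f.coeff n := by
  cases n with
  | zero => simp
  | succ n => rw [coeff_X_mul, coeff_derivative]; push_cast; ring

section Functional

variable {L : ℝ[X] →ₗ[ℝ] ℝ} {p : ℕ → ℝ[X]}

theorem functional_mul_eq_zero (hm : ∀ n, (p n).Monic) (hd : ∀ n, (p n).natDegree = n)
    (f : ℝ[X]) (N : ℕ) (hf : ∀ j < N, L (f * p j) = 0) (g : ℝ[X]) (hg : g.degree < N) :
    L (f * g) = 0 := by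
  induction N generalizing g with
  | zero =>
    have : g = 0 := by simpa using hg
    simp [this]
  | succ N ih =>
    have hc : (p N).coeff N = 1 := by
      have := hm N
      rwa [Monic, leadingCoeff, hd] at this
    have h1 : (g - C (g.coeff N) * p N).degree < N := by
      rw [degree_lt_iff_coeff_zero] at hg ⊢
      intro m hmN
      rcases hmN.eq_or_lt with rfl | h
      · simp [hc]
      · have h2 : (p N).coeff m = 0 := coeff_eq_zero_of_natDegree_lt (by rw [hd]; exact h)
        rw [coeff_sub, coeff_C_mul, hg m h, h2]
        simp
    have h2 := ih (fun j hj => hf j (by omega)) _ h1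
    have h3 : f * g = f * (g - C (g.coeff N) * p N) + (g.coeff N) • (f * p N) := by
      rw [smul_eq_C_mul]; ring
    rw [h3, map_add, map_smul, h2, hf N (by omega)]
    simp

theorem eq_of_functional_mul_eq (hpos : ∀ f : ℝ[X], L (f * f) = 0 → f = 0)
    (hm : ∀ n, (p n).Monic) (hd : ∀ n, (p n).natDegree = n)
    (f g : ℝ[X]) (N : ℕ) (hfg : ∀ m, N ≤ m → f.coeff m = g.coeff m)
    (h : ∀ j < N, L (f * p j) = L (g * p j)) : f = g := by
  refine sub_eq_zero.1 (hpos _ (functional_mul_eq_zero hm hd _ N ?_ _ ?_))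
  · intro j hj
    rw [sub_mul, map_sub, h j hj, sub_self]
  · rw [degree_lt_iff_coeff_zero]
    intro m hmN
    rw [coeff_sub, hfg m hmN, sub_self]

variable {a : ℝ}

theorem functional_derivative_mul
    (hL : ∀ f : ℝ[X], L (X * derivative f + (C (a + 1) - X) * f) = 0) (f g : ℝ[X]) :
    L (X * derivative f * g) = - L (f * (X * derivative g + (C (a + 1) - X) * g)) := by
  rw [eq_neg_iff_add_eq_zero, ← map_add, ← hL (f * g), derivative_mul]
  congr 1
  ring

/-- `p` is a monic orthogonal family for a definite functional `L` satisfying the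
integration-by-parts identity of the Laguerre weight with parameter `a`. -/
structure IsOrth (L : ℝ[X] →ₗ[ℝ] ℝ) (p : ℕ → ℝ[X]) (a : ℝ) : Prop where
  byParts : ∀ f : ℝ[X], L (X * derivative f + (C (a + 1) - X) * f) = 0
  definite : ∀ f : ℝ[X], L (f * f) = 0 → f = 0
  monic : ∀ n, (p n).Monic
  natDegree : ∀ n, (p n).natDegree = n
  orthogonal : ∀ n m, n ≠ m → L (p n * p m) = 0

namespace IsOrth

variable (H : IsOrth L p a)
include H

theorem coeff_self (n : ℕ) : (p n).coeff n = 1 := by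
  have := H.monic n
  rwa [Monic, leadingCoeff, H.natDegree] at this

theorem coeff_of_lt {n m : ℕ} (h : n < m) : (p n).coeff m = 0 :=
  coeff_eq_zero_of_natDegree_lt (by rw [H.natDegree]; exact h)

theorem functional_mul_of_degree_lt (n : ℕ) (g : ℝ[X]) (hg : ∀ m, n ≤ m → g.coeff m = 0) :
    L (p n * g) = 0 :=
  functional_mul_eq_zero H.monic H.natDegree _ n
    (fun j hj => H.orthogonal n j (by omega)) g ((degree_lt_iff_coeff_zero _ _).2 hg)

theorem functional_self_ne_zero (n : ℕ) : L (p n * p n) ≠ 0 :=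
  fun h => (H.monic n).ne_zero (H.definite _ h)

theorem functional_X_mul (n : ℕ) : L (p (n + 1) * (X * p n)) = L (p (n + 1) * p (n + 1)) := by
  rw [← sub_eq_zero, ← map_sub, ← mul_sub]
  apply H.functional_mul_of_degree_lt
  intro m hm
  obtain ⟨m, rfl⟩ : ∃ k, m = k + 1 := ⟨m - 1, by omega⟩
  rw [coeff_sub, coeff_X_mul]
  rcases hm.eq_or_lt with h | h
  · obtain rfl : n = m := by omega
    simp [H.coeff_self]
  · rw [H.coeff_of_lt h, H.coeff_of_lt (by omega), sub_self]

theorem functional_derivative_lower {n j : ℕ} (hj : j < n + 1) :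
    L (X * derivative (p (n + 1)) * p j) =
      if j = n then L (p (n + 1) * p (n + 1)) else 0 := by
  rw [functional_derivative_mul H.byParts]
  split_ifs with h
  · subst h
    rw [← H.functional_X_mul, ← sub_eq_zero, ← neg_eq_zero, sub_eq_add_neg, neg_add, neg_neg,
      neg_neg, ← map_add, ← mul_add]
    apply H.functional_mul_of_degree_lt
    intro m hm
    have : X * derivative (p j) + (C (a + 1) - X) * p j + X * p j
      = X * derivative (p j) + C (a + 1) * p j := by ring
    rw [this, coeff_add, coeff_X_mul_derivative_eq, coeff_C_mul, H.coeff_of_lt (by omega)]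
    simp
  · rw [neg_eq_zero]
    apply H.functional_mul_of_degree_lt
    intro m hm
    obtain ⟨m, rfl⟩ : ∃ k, m = k + 1 := ⟨m - 1, by omega⟩
    rw [sub_mul, coeff_add, coeff_sub, coeff_X_mul_derivative_eq, coeff_C_mul, coeff_X_mul,
      H.coeff_of_lt (by omega), H.coeff_of_lt (by omega)]
    simp

theorem X_mul_derivative (n : ℕ) :
    X * derivative (p (n + 1)) = C ((n : ℝ) + 1) * p (n + 1) +
      C (L (p (n + 1) * p (n + 1)) / L (p n * p n)) * p n := by
  refine eq_of_functional_mul_eq H.definite H.monic H.natDegree _ _ (n + 1) ?_ ?_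
  · intro m hm
    rw [coeff_X_mul_derivative_eq, coeff_add, coeff_C_mul, coeff_C_mul,
      H.coeff_of_lt (show n < m by omega)]
    rcases hm.eq_or_lt with rfl | h
    · simp
    · simp [H.coeff_of_lt h]
  · intro j hj
    rw [H.functional_derivative_lower hj, add_mul, mul_assoc, mul_assoc, map_add,
      ← smul_eq_C_mul, ← smul_eq_C_mul, map_smul, map_smul, H.orthogonal (n + 1) j (by omega)]
    split_ifs with h
    · subst h
      have := H.functional_self_ne_zero j
      simp [this]
    · simp [H.orthogonal n j (Ne.symm h)]

theorem skew_succ_ratio (n : ℕ) :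
    (X - C (a + 1)) * p (n + 1) - 2 * (X * derivative (p (n + 1))) = p (n + 2) -
      C (L (p (n + 1) * p (n + 1)) / L (p n * p n)) * p n := by
  refine eq_of_functional_mul_eq H.definite H.monic H.natDegree _ _ (n + 2) ?_ ?_
  · intro m hm
    obtain ⟨m, rfl⟩ : ∃ k, m = k + 1 := ⟨m - 1, by omega⟩
    have : (2 : ℝ[X]) = C 2 := (map_ofNat C 2).symm
    rw [this, sub_mul, coeff_sub, coeff_sub, coeff_sub, coeff_C_mul, coeff_C_mul, coeff_C_mul,
      coeff_X_mul_derivative_eq, coeff_X_mul,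
      H.coeff_of_lt (show n < m + 1 by omega), H.coeff_of_lt (show n + 1 < m + 1 by omega)]
    rcases hm.eq_or_lt with h | h
    · obtain rfl : n + 1 = m := by omega
      simp [H.coeff_self]
    · simp [H.coeff_of_lt h, H.coeff_of_lt (show n + 1 < m by omega)]
  · intro j hj
    have key : L (((X - C (a + 1)) * p (n + 1) - 2 * (X * derivative (p (n + 1)))) * p j)
        = L (p (n + 1) * (X * derivative (p j))) - L (X * derivative (p (n + 1)) * p j) := by
      have h0 := H.byParts (p (n + 1) * p j)
      rw [← sub_eq_zero, ← neg_eq_zero, ← h0, ← map_sub, ← map_sub, ← map_neg, derivative_mul]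
      congr 1
      ring
    rw [key, sub_mul, map_sub, H.orthogonal (n + 2) j (by omega),
      mul_assoc (C _), ← smul_eq_C_mul, map_smul]
    rcases (show j ≤ n + 1 by omega).eq_or_lt with rfl | h
    · rw [mul_comm, sub_self, H.orthogonal n (n + 1) (by omega)]
      simp
    · rw [H.functional_derivative_lower h, H.functional_mul_of_degree_lt]
      · split_ifs with h
        · subst h
          have := H.functional_self_ne_zero j
          simp [this]
        · simp [H.orthogonal n j (Ne.symm h)]
      · intro m hm
        rw [coeff_X_mul_derivative_eq, H.coeff_of_lt (by omega), mul_zero]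

theorem eq_one : p 0 = 1 := by
  exact (H.monic 0).natDegree_eq_zero.1 (H.natDegree 0)

theorem one_eq : p 1 = X - C (a + 1) := by
  refine eq_of_functional_mul_eq H.definite H.monic H.natDegree _ _ 1 ?_ ?_
  · intro m hm
    rcases hm.eq_or_lt with rfl | h
    · rw [H.coeff_self, coeff_sub, coeff_X_one, coeff_C_of_ne_zero one_ne_zero, sub_zero]
    · rw [H.coeff_of_lt h, coeff_sub, coeff_X_of_ne_one (by omega), coeff_C_of_ne_zero (by omega)]
      simp
  · intro j hj
    obtain rfl : j = 0 := by omega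
    rw [H.orthogonal _ _ (by omega), H.eq_one]
    have := H.byParts 1
    rw [eq_comm, ← neg_eq_zero, ← this, ← map_neg]
    congr 1
    simp

theorem coeff_next (n : ℕ) : (p (n + 1)).coeff n = - (((n : ℝ) + 1) * (n + 1 + a)) := by
  induction n with
  | zero => rw [H.one_eq]; simp [coeff_X]; ring
  | succ n ih =>
    have h := congrArg (fun f => coeff f (n + 1)) (H.skew_succ_ratio n)
    have h2 : (2 : ℝ[X]) = C 2 := (map_ofNat C 2).symm
    simp only [h2, sub_mul, coeff_sub, coeff_C_mul, coeff_X_mul_derivative_eq] at h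
    rw [coeff_X_mul, ih, H.coeff_self, H.coeff_of_lt (Nat.lt_succ_self n)] at h
    push_cast at h ⊢
    linarith

theorem functional_ratio (n : ℕ) :
    L (p (n + 1) * p (n + 1)) / L (p n * p n) = ((n : ℝ) + 1) * (n + 1 + a) := by
  have h := congrArg (fun f => coeff f n) (H.X_mul_derivative n)
  simp only [coeff_add, coeff_C_mul, coeff_X_mul_derivative_eq, H.coeff_self, H.coeff_next] at h
  linarith

theorem skew_succ (n : ℕ) :
    (X - C (a + 1)) * p (n + 1) - 2 * (X * derivative (p (n + 1))) = p (n + 2) -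
      C (((n : ℝ) + 1) * (n + 1 + a)) * p n := by
  rw [H.skew_succ_ratio, H.functional_ratio]

theorem functional_self (ha : -1 < a) (h1 : L 1 = Real.Gamma (a + 1)) (n : ℕ) :
    L (p n * p n) = Real.Gamma (n + 1) * Real.Gamma (n + a + 1) := by
  induction n with
  | zero => simp [H.eq_one, h1]
  | succ n ih =>
    have hr := H.functional_ratio n
    rw [div_eq_iff (H.functional_self_ne_zero n), ih] at hr
    have hn : (0 : ℝ) ≤ n := n.cast_nonneg
    have e1 := Real.Gamma_add_one (s := (n : ℝ) + 1) (by positivity)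
    have e2 := Real.Gamma_add_one (s := (n : ℝ) + a + 1) (by linarith)
    rw [hr]
    push_cast
    rw [e1, show (n : ℝ) + 1 + a + 1 = n + a + 1 + 1 by ring, e2]
    ring

end IsOrth

end Functional
theorem integrableOn_eval_mul_rpow_mul_exp (f : ℝ[X]) {s b : ℝ} (hs : -1 < s) (hb : 0 < b) :
    IntegrableOn (fun z : ℝ => f.eval z * (z ^ s * Real.exp (-b * z))) (Set.Ioi 0) := by
  induction f using Polynomial.induction_on' with
  | add f g hf hg =>
    refine (hf.add hg).congr_fun (fun z _ => ?_) measurableSet_Ioi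
    simp only [Pi.add_apply, eval_add]
    ring
  | monomial n c =>
    have hn : (0 : ℝ) ≤ n := n.cast_nonneg
    have h := (integrableOn_rpow_mul_exp_neg_mul_rpow (p := 1) (s := n + s) (b := b)
      (by linarith) one_pos hb).const_mul c
    refine IntegrableOn.congr_fun h (fun z hz => ?_) measurableSet_Ioi
    have hz : (0 : ℝ) < z := hz
    simp only [eval_monomial, Real.rpow_one]
    rw [Real.rpow_add hz, Real.rpow_natCast]
    ring

/-- Integration of polynomials against the Laguerre weight `z ^ a * exp (-z)`. -/
noncomputable def laguerreFunctional (a : ℝ) : ℝ[X] →ₗ[ℝ] ℝ :=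
  lsum fun k => Real.Gamma (a + k + 1) • LinearMap.id

theorem laguerreFunctional_monomial (a : ℝ) (n : ℕ) (c : ℝ) :
    laguerreFunctional a (monomial n c) = Real.Gamma (a + n + 1) * c := by
  simp [laguerreFunctional, lsum, sum_monomial_index]

theorem laguerreFunctional_eq_integral {a : ℝ} (ha : -1 < a) (f : ℝ[X]) :
    laguerreFunctional a f = ∫ z in Set.Ioi (0 : ℝ), f.eval z * (z ^ a * Real.exp (-z)) := by
  have hint := fun f : ℝ[X] => integrableOn_eval_mul_rpow_mul_exp f ha one_pos
  simp only [neg_mul, one_mul] at hint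
  induction f using Polynomial.induction_on' with
  | add f g hf hg =>
    simp only [map_add, hf, hg, eval_add, add_mul]
    rw [integral_add (hint f) (hint g)]
  | monomial n c =>
    have hn : (0 : ℝ) ≤ n := n.cast_nonneg
    rw [laguerreFunctional_monomial, Real.Gamma_eq_integral (by linarith), mul_comm,
      ← integral_const_mul]
    refine setIntegral_congr_fun measurableSet_Ioi fun z hz => ?_
    have hz : (0 : ℝ) < z := hz
    simp only [eval_monomial]
    rw [add_sub_cancel_right, Real.rpow_add hz, Real.rpow_natCast]
    ring

theorem laguerreFunctional_by_parts {a : ℝ} (ha : -1 < a) (f : ℝ[X]) :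
    laguerreFunctional a (X * derivative f + (C (a + 1) - X) * f) = 0 := by
  induction f using Polynomial.induction_on' with
  | add f g hf hg =>
    rw [← add_zero (0 : ℝ)]
    nth_rw 1 [← hf]
    rw [← hg, ← map_add, derivative_add]
    congr 1
    ring
  | monomial n c =>
    have hn : (0 : ℝ) ≤ n := n.cast_nonneg
    have h : X * derivative (monomial n c) + (C (a + 1) - X) * monomial n c
        = monomial n ((a + n + 1) * c) - monomial (n + 1) c := by
      ext k
      rw [coeff_add, coeff_X_mul_derivative_eq, sub_mul, coeff_sub, coeff_C_mul, X_mul_monomial,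
        coeff_sub, coeff_monomial, coeff_monomial, coeff_monomial]
      split_ifs with hk
      · subst hk; ring
      · subst hk; ring
      · ring
      · ring
    rw [h, map_sub, laguerreFunctional_monomial, laguerreFunctional_monomial]
    push_cast
    rw [show a + ((n : ℝ) + 1) + 1 = (a + n + 1) + 1 by ring,
      Real.Gamma_add_one (s := a + n + 1) (by linarith)]
    ring

theorem laguerreFunctional_definite {a : ℝ} (ha : -1 < a) (f : ℝ[X])
    (h : laguerreFunctional a (f * f) = 0) : f = 0 := by
  by_contra hf
  have hint := integrableOn_eval_mul_rpow_mul_exp (f * f) ha one_pos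
  simp only [neg_mul, one_mul] at hint
  rw [laguerreFunctional_eq_integral ha] at h
  refine h.not_gt ((setIntegral_pos_iff_support_of_nonneg_ae ?_ hint).2 ?_)
  · filter_upwards [ae_restrict_mem measurableSet_Ioi] with z hz
    have hz : (0 : ℝ) < z := hz
    rw [eval_mul]
    have := mul_self_nonneg (f.eval z)
    simp only [Pi.zero_apply]
    positivity
  · have hsub : Set.Ioi (0 : ℝ) \ {z | f.IsRoot z} ⊆
        Function.support (fun z : ℝ => (f * f).eval z * (z ^ a * Real.exp (-z)))
          ∩ Set.Ioi 0 := by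
      rintro z ⟨hz, hr⟩
      have hz' : (0 : ℝ) < z := hz
      refine ⟨?_, hz⟩
      have hr : f.eval z ≠ 0 := hr
      have h1 : (0 : ℝ) < z ^ a * Real.exp (-z) := by positivity
      rw [Function.mem_support, eval_mul]
      exact mul_ne_zero (mul_ne_zero hr hr) h1.ne'
    refine lt_of_lt_of_le ?_ (measure_mono hsub)
    rw [measure_sdiff_null ((finite_setOfPred_isRoot hf).measure_zero _), Real.volume_Ioi]
    exact ENNReal.zero_lt_top

theorem hasDerivAt_eval_mul_rpow_mul_exp (f : ℝ[X]) (s b : ℝ) {z : ℝ} (hz : 0 < z) :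
    HasDerivAt (fun z : ℝ => f.eval z * (z ^ (s + 1) * Real.exp (-b * z)))
      ((X * derivative f + (C (s + 1) - C b * X) * f).eval z * (z ^ s * Real.exp (-b * z))) z := by
  have h1 := Real.hasDerivAt_rpow_const (p := s + 1) (Or.inl hz.ne')
  have h2 := ((hasDerivAt_id z).const_mul (-b)).exp
  refine ((f.hasDerivAt z).mul (h1.mul h2)).congr_deriv ?_
  simp only [eval_add, eval_sub, eval_mul, eval_X, eval_C, Pi.mul_apply, id]
  rw [add_sub_cancel_right, Real.rpow_add_one hz.ne']
  ring

/-- The primitive `f z * z ^ (s + 1) * exp (-b z)` inverts the sign kernel. -/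
theorem integral_mul_sign (f : ℝ[X]) {s b : ℝ} (hs : -1 < s) (hb : 0 < b) {y : ℝ} (hy : 0 < y) :
    ∫ z in Set.Ioi (0 : ℝ), (X * derivative f + (C (s + 1) - C b * X) * f).eval z
        * (z ^ s * Real.exp (-b * z)) * Real.sign (z - y)
      = -2 * (f.eval y * (y ^ (s + 1) * Real.exp (-b * y))) := by
  set F : ℝ → ℝ := fun z => f.eval z * (z ^ (s + 1) * Real.exp (-b * z)) with hF
  set F' : ℝ → ℝ := fun z => (X * derivative f + (C (s + 1) - C b * X) * f).eval z
        * (z ^ s * Real.exp (-b * z)) with hF'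
  have hderiv : ∀ z : ℝ, 0 < z → HasDerivAt F (F' z) z := fun z hz =>
    hasDerivAt_eval_mul_rpow_mul_exp f s b hz
  have hint : IntegrableOn F' (Set.Ioi 0) := integrableOn_eval_mul_rpow_mul_exp _ hs hb
  have hlim : Filter.Tendsto F Filter.atTop (nhds 0) :=
    tendsto_zero_of_hasDerivAt_of_integrableOn_Ioi (fun z hz => hderiv z hz) hint
      (integrableOn_eval_mul_rpow_mul_exp f (by linarith) hb)
  have hcont : Continuous F := by
    have := Real.continuous_rpow_const (q := s + 1) (by linarith)
    have := f.continuous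
    fun_prop
  have hIoi : ∫ z in Set.Ioi y, F' z = 0 - F y :=
    integral_Ioi_of_hasDerivAt_of_tendsto' (fun z hz => hderiv z (hy.trans_le hz))
      (hint.mono_set (Set.Ioi_subset_Ioi hy.le)) hlim
  have hintIoc : IntegrableOn F' (Set.Ioc 0 y) := hint.mono_set Set.Ioc_subset_Ioi_self
  have hIoc : ∫ z in Set.Ioc 0 y, F' z = F y - F 0 := by
    rw [← intervalIntegral.integral_of_le hy.le]
    exact intervalIntegral.integral_eq_sub_of_hasDerivAt_of_le hy.le hcont.continuousOn
      (fun z hz => hderiv z hz.1) ((intervalIntegrable_iff_integrableOn_Ioc_of_le hy.le).2 hintIoc)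
  have hF0 : F 0 = 0 := by
    simp [hF, Real.zero_rpow (show s + 1 ≠ 0 by linarith)]
  have e1 : ∫ z in Set.Ioi y, F' z * Real.sign (z - y) = ∫ z in Set.Ioi y, F' z :=
    setIntegral_congr_fun measurableSet_Ioi fun z hz => by
      simp [Real.sign_of_pos (sub_pos.2 (show y < z from hz))]
  have e2 : ∫ z in Set.Ioc 0 y, F' z * Real.sign (z - y) = -∫ z in Set.Ioc 0 y, F' z := by
    rw [← integral_neg, integral_Ioc_eq_integral_Ioo, integral_Ioc_eq_integral_Ioo]
    exact setIntegral_congr_fun measurableSet_Ioo fun z hz => by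
      simp [Real.sign_of_neg (sub_neg.2 hz.2)]
  have hsign : IntegrableOn (fun z => F' z * Real.sign (z - y)) (Set.Ioi 0) := by
    refine Integrable.mul_bdd (c := 1) hint ?_ ?_
    · have hm : Measurable Real.sign := by
        refine Measurable.ite measurableSet_Iio measurable_const
          (Measurable.ite measurableSet_Ioi measurable_const measurable_const)
      exact (hm.comp (measurable_id.sub_const y)).aestronglyMeasurable
    · refine Filter.Eventually.of_forall fun z => ?_
      rcases Real.sign_apply_eq (z - y) with h | h | h <;> simp [h]
  rw [← Set.Ioc_union_Ioi_eq_Ioi hy.le, setIntegral_union (Set.Ioc_disjoint_Ioi le_rfl)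
    measurableSet_Ioi (hsign.mono_set Set.Ioc_subset_Ioi_self)
    (hsign.mono_set (Set.Ioi_subset_Ioi hy.le)), e1, e2, hIoi, hIoc, hF0]
  ring


/-- **Laguerre case, β = 1 pairing**: for the monic Laguerre polynomials `p_n^{(a)}`,
`⟨p_{2m}^{(a)}, p_{2n+1}^{(a)} - 2n(2n+a) p_{2n-1}^{(a)}⟩_1 = 2 Γ(2n+1) Γ(2n+a+1) δ_{n,m}`,
where the β = 1 skew inner product has one-body weight `z^{(a-1)/2} e^{-z/2}` on `(0,∞)`. -/
theorem statement8 (a : ℝ) (ha : -1 < a)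
    (p : ℤ → Polynomial ℝ) (hpneg : p (-1) = 0)
    (hmonic : ∀ n : ℕ, (p n).Monic) (hdeg : ∀ n : ℕ, (p n).natDegree = n)
    (horth : ∀ n m : ℕ, n ≠ m →
      ∫ z in Set.Ioi (0 : ℝ), (p n).eval z * (p m).eval z * z ^ a * Real.exp (-z) = 0) :
    ∀ m n : ℕ,
      (1 / 2 : ℝ) * ∫ y in Set.Ioi (0 : ℝ), ∫ z in Set.Ioi (0 : ℝ),
          (p (2 * m)).eval y
            * ((p (2 * n + 1)).eval z
              - 2 * (n : ℝ) * (2 * (n : ℝ) + a) * (p (2 * n - 1)).eval z)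
            * Real.sign (z - y)
            * (y ^ ((a - 1) / 2) * Real.exp (-y / 2))
            * (z ^ ((a - 1) / 2) * Real.exp (-z / 2))
        = if n = m then 2 * Real.Gamma (2 * n + 1) * Real.Gamma (2 * n + a + 1) else 0 := by
  have H : IsOrth (laguerreFunctional a) (fun n : ℕ => p n) a :=
    { byParts := laguerreFunctional_by_parts ha
      definite := laguerreFunctional_definite ha
      monic := hmonic
      natDegree := hdeg
      orthogonal := fun n m hnm => by
        have h := horth n m hnm
        rw [laguerreFunctional_eq_integral ha]
        simpa only [eval_mul, mul_assoc] using h }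
  intro m n
  have hskew : p (2 * n + 1) - C (2 * (n : ℝ) * (2 * n + a)) * p (2 * n - 1)
      = C (-2) * (X * derivative (p (2 * n)) +
        (C ((a - 1) / 2 + 1) - C (1 / 2) * X) * p (2 * n)) := by
    have hC : C (-2) * (X * derivative (p (2 * n)) +
        (C ((a - 1) / 2 + 1) - C (1 / 2) * X) * p (2 * n)) =
        (X - C (a + 1)) * p (2 * n) - 2 * (X * derivative (p (2 * n))) := by
      have h2 : (2 : ℝ[X]) = C 2 := (map_ofNat C 2).symm
      have e1 : C (-2 : ℝ) = - C 2 := C_neg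
      have e2 : C (a + 1) = C 2 * C ((a - 1) / 2 + 1) := by
        rw [← C_mul]; congr 1; ring
      have e3 : C (2 : ℝ) * C (1 / 2) = 1 := by
        rw [← C_mul, ← C_1]; congr 1; norm_num
      rw [h2, e1, e2]
      linear_combination X * p (2 * n) * e3
    rw [hC]
    rcases n with _ | k
    · have h0 := H.eq_one
      have h1 := H.one_eq
      simp only [Nat.cast_zero, Nat.cast_one] at h0 h1
      simp [h0, h1, hpneg]
    · have := H.skew_succ (2 * k + 1)
      push_cast at this ⊢
      rw [show (2 * ((k : ℤ) + 1)) = 2 * k + 1 + 1 by ring, this,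
        show (2 * (k : ℤ) + 1 + 2) = 2 * k + 1 + 1 + 1 by ring,
        show (2 * (k : ℤ) + 1 + 1 - 1) = 2 * k + 1 by ring]
      congr 3
      ring_nf
  have hinner : ∀ y ∈ Set.Ioi (0 : ℝ), (∫ z in Set.Ioi (0 : ℝ),
          (p (2 * m)).eval y
            * ((p (2 * n + 1)).eval z
              - 2 * (n : ℝ) * (2 * (n : ℝ) + a) * (p (2 * n - 1)).eval z)
            * Real.sign (z - y)
            * (y ^ ((a - 1) / 2) * Real.exp (-y / 2))
            * (z ^ ((a - 1) / 2) * Real.exp (-z / 2)))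
        = 4 * ((p (2 * m) * p (2 * n)).eval y * (y ^ a * Real.exp (-y))) := by
    intro y hy
    have hy : (0 : ℝ) < y := hy
    have h := integral_mul_sign (p (2 * n)) (s := (a - 1) / 2) (b := 1 / 2) (by linarith)
      (by norm_num) hy
    have hpow : y ^ a = y ^ ((a - 1) / 2) * y ^ ((a - 1) / 2 + 1) := by
      rw [← Real.rpow_add hy]; congr 1; ring
    have hexp : Real.exp (-y) = Real.exp (-y / 2) * Real.exp (-(1 / 2) * y) := by
      rw [← Real.exp_add]; congr 1; ring
    trans (-2 * ((p (2 * m)).eval y * (y ^ ((a - 1) / 2) * Real.exp (-y / 2)))) *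
      (-2 * ((p (2 * n)).eval y * (y ^ ((a - 1) / 2 + 1) * Real.exp (-(1 / 2) * y))))
    · rw [← h, ← integral_const_mul]
      refine integral_congr_ae (Filter.Eventually.of_forall fun z => ?_)
      have hz := congrArg (eval z) hskew
      rw [eval_sub, eval_C_mul, eval_C_mul] at hz
      simp only [hz, show -z / 2 = -(1 / 2) * z by ring]
      ring
    · rw [hpow, hexp, eval_mul]
      ring
  rw [setIntegral_congr_fun measurableSet_Ioi hinner, integral_const_mul,
    ← laguerreFunctional_eq_integral ha]
  split_ifs with hnm
  · subst hnm
    have h1 : laguerreFunctional a 1 = Real.Gamma (a + 1) := by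
      simpa using laguerreFunctional_monomial a 0 1
    have := H.functional_self ha h1 (2 * n)
    push_cast at this
    rw [this]
    ring
  · have := H.orthogonal (2 * m) (2 * n) (by omega)
    push_cast at this
    rw [this]
    ring
end

section
/- Fix X ∈ ℝ and a > −1. Let {α_j}_{j≥−1} be the real sequence determined by α_{−1} = 0, α_0 = 1 and the recurrence (2j+1)(2j+2)(2j+a+1)(2j+a+2) α_{j+1} − (4X² + (2j+1)(2j+a+1) + 2j(2j+a)) α_j + α_{j−1} = 0 for all j ≥ 0. Then for every j ≥ 0, α_j = (1/(2j)!) · Σ_{k=0}^{j} [(−j)_k · ((a+1)/2 − X)_k · ((a+1)/2 + X)_k] / [((a+2)/2)_k · ((a+1)/2)_k · k!], i.e. α_j equals (1/(2j)!) times the terminating hypergeometric series ₃F₂(−j, (a+1)/2 − X, (a+1)/2 + X; (a+2)/2, (a+1)/2; 1), a continuous dual Hahn polynomial in the variable −X². -/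
open Finset

theorem ascPochhammer_eval_succ_left (x : ℝ) (n : ℕ) :
    (ascPochhammer ℝ (n + 1)).eval x = x * (ascPochhammer ℝ n).eval (x + 1) := by
  simp [ascPochhammer_succ_left]

/-- Sums `∑ (-x)_k c_k` whose coefficients have the term ratio of a continuous dual Hahn series with
parameters `A, 1/2, 0` satisfy the corresponding difference equation in `x`, up to a boundary
term. -/
theorem sum_ascPochhammer_difference_eq (X A x : ℝ) (c : ℕ → ℝ)
    (hc : ∀ k : ℕ, c (k + 1) * ((A + 1 / 2 + k) * (A + k) * (k + 1)) = c k * ((A + k) ^ 2 - X ^ 2))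
    (N : ℕ) :
    (x + A + 1 / 2) * (x + A) *
        (∑ k ∈ range (N + 1), (ascPochhammer ℝ k).eval (-(x + 1)) * c k
          - ∑ k ∈ range (N + 1), (ascPochhammer ℝ k).eval (-x) * c k)
      - x * (x - 1 / 2) *
        (∑ k ∈ range (N + 1), (ascPochhammer ℝ k).eval (-x) * c k
          - ∑ k ∈ range (N + 1), (ascPochhammer ℝ k).eval (-(x - 1)) * c k)
      - (X ^ 2 - A ^ 2) * ∑ k ∈ range (N + 1), (ascPochhammer ℝ k).eval (-x) * c k
      = (ascPochhammer ℝ N).eval (-x) * ((A + N) ^ 2 - X ^ 2) * c N := by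
  induction N with
  | zero => simp; ring
  | succ N ih =>
    rw [sum_range_succ _ (N + 1), sum_range_succ _ (N + 1), sum_range_succ _ (N + 1)]
    have h1 : (ascPochhammer ℝ (N + 1)).eval (-(x + 1))
        = -(x + 1) * (ascPochhammer ℝ N).eval (-x) := by
      rw [ascPochhammer_eval_succ_left]; congr 2; ring
    have h2 : (ascPochhammer ℝ (N + 1)).eval (-x)
        = (ascPochhammer ℝ N).eval (-x) * (-x + N) := ascPochhammer_succ_eval N (-x)
    have h3 : (ascPochhammer ℝ (N + 1)).eval (-(x - 1))
        = (ascPochhammer ℝ N).eval (-(x - 1)) * (-(x - 1) + N) :=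
      ascPochhammer_succ_eval N (-(x - 1))
    have h4 : x * (ascPochhammer ℝ N).eval (-(x - 1))
        = -((ascPochhammer ℝ N).eval (-x) * (-x + N)) := by
      rw [← h2, ascPochhammer_eval_succ_left, show -x + 1 = -(x - 1) by ring]; ring
    rw [h1, h2, h3]
    push_cast
    linear_combination ih - (ascPochhammer ℝ N).eval (-x) * hc N
      + (x - 1 / 2) * (-(x - 1) + N) * c (N + 1) * h4

theorem sum_ascPochhammer_neg_natCast (c : ℕ → ℝ) {n N : ℕ} (h : n < N) :
    ∑ k ∈ range N, (ascPochhammer ℝ k).eval (-(n : ℝ)) * c k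
      = ∑ k ∈ range (n + 1), (ascPochhammer ℝ k).eval (-(n : ℝ)) * c k := by
  symm
  refine sum_subset (range_subset_range.2 h) fun k _ hk => ?_
  rw [ascPochhammer_eval_neg_coe_nat_of_lt (by simpa using hk), zero_mul]

/-- A terminating series `∑ (-n)_k c_k` whose coefficients have the term ratio of a continuous dual
Hahn series satisfies a three-term recurrence in `n`. -/
theorem sum_ascPochhammer_recurrence (X A : ℝ) (c : ℕ → ℝ)
    (hc : ∀ k : ℕ, c (k + 1) * ((A + 1 / 2 + k) * (A + k) * (k + 1)) = c k * ((A + k) ^ 2 - X ^ 2))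
    {T : ℕ → ℝ} (hT : ∀ n : ℕ, T n = ∑ k ∈ range (n + 1), (ascPochhammer ℝ k).eval (-(n : ℝ)) * c k)
    (n : ℕ) :
    (n + A + 1 / 2) * (n + A) * (T (n + 1) - T n) - n * (n - 1 / 2) * (T n - T (n - 1))
      = (X ^ 2 - A ^ 2) * T n := by
  have h := sum_ascPochhammer_difference_eq X A n c hc (n + 1)
  rw [ascPochhammer_eval_neg_coe_nat_of_lt n.lt_succ_self,
    sum_ascPochhammer_neg_natCast c (show n < n + 1 + 1 by lia), ← hT,
    ← Nat.cast_succ, ← Nat.succ_eq_add_one n, ← hT] at h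
  rcases n with _ | m
  · simp at h ⊢
    linear_combination h
  · rw [show (((m + 1 : ℕ) : ℝ) - 1) = (m : ℝ) by simp,
      sum_ascPochhammer_neg_natCast c (show m < m + 1 + 1 + 1 by lia), ← hT] at h
    simp only [Nat.add_sub_cancel, Nat.succ_eq_add_one] at h ⊢
    linear_combination h

/-- **Laguerre case, expansion coefficients**: the solution of the recurrence
`(2j+1)(2j+2)(2j+a+1)(2j+a+2) α_{j+1} - (4X² + (2j+1)(2j+a+1) + 2j(2j+a)) α_j + α_{j-1} = 0`,
`α_{-1} = 0`, `α_0 = 1`, is the continuous dual Hahn polynomial value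
`α_j = (1/(2j)!) ₃F₂(-j, (a+1)/2 - X, (a+1)/2 + X; (a+2)/2, (a+1)/2; 1)`,
written out via Pochhammer symbols. -/
theorem statement10 (X a : ℝ) (ha : -1 < a) (α : ℤ → ℝ)
    (hneg : α (-1) = 0) (h0 : α 0 = 1)
    (hrec : ∀ j : ℕ,
      (2 * (j : ℝ) + 1) * (2 * (j : ℝ) + 2) * (2 * (j : ℝ) + a + 1) * (2 * (j : ℝ) + a + 2)
          * α (j + 1)
        - (4 * X ^ 2 + (2 * (j : ℝ) + 1) * (2 * (j : ℝ) + a + 1)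
            + 2 * (j : ℝ) * (2 * (j : ℝ) + a)) * α j
        + α ((j : ℤ) - 1) = 0) :
    ∀ j : ℕ,
      α j = (1 / (Nat.factorial (2 * j) : ℝ)) *
        ∑ k ∈ Finset.range (j + 1),
          ((ascPochhammer ℝ k).eval (-(j : ℝ))
            * (ascPochhammer ℝ k).eval ((a + 1) / 2 - X)
            * (ascPochhammer ℝ k).eval ((a + 1) / 2 + X))
          / ((ascPochhammer ℝ k).eval ((a + 2) / 2)
            * (ascPochhammer ℝ k).eval ((a + 1) / 2)
            * (Nat.factorial k : ℝ)) := by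
  set A : ℝ := (a + 1) / 2 with hA
  have hA0 : 0 < A := by rw [hA]; linarith
  have hD : (a + 2) / 2 = A + 1 / 2 := by rw [hA]; ring
  have haA : a = 2 * A - 1 := by rw [hA]; ring
  rw [hD]
  set c : ℕ → ℝ := fun k => (ascPochhammer ℝ k).eval (A - X) * (ascPochhammer ℝ k).eval (A + X)
    / ((ascPochhammer ℝ k).eval (A + 1 / 2) * (ascPochhammer ℝ k).eval A * (k.factorial : ℝ))
    with hcdef
  have hc : ∀ k : ℕ, c (k + 1) * ((A + 1 / 2 + k) * (A + k) * (k + 1))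
      = c k * ((A + k) ^ 2 - X ^ 2) := by
    intro k
    have h1 := ascPochhammer_pos k A hA0
    have h2 := ascPochhammer_pos k (A + 1 / 2) (by linarith)
    simp only [hcdef, ascPochhammer_succ_eval, Nat.factorial_succ, Nat.cast_mul, Nat.cast_succ]
    rw [div_mul_eq_mul_div, div_mul_eq_mul_div, div_eq_div_iff (by positivity) (by positivity)]
    ring
  set T : ℕ → ℝ := fun n => ∑ k ∈ range (n + 1), (ascPochhammer ℝ k).eval (-(n : ℝ)) * c k
    with hTdef
  have hT := sum_ascPochhammer_recurrence X A c hc (T := T) fun _ => rfl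
  suffices H : ∀ j : ℕ, ((2 * j).factorial : ℝ) * α j = T j by
    intro j
    have hf : ((2 * j).factorial : ℝ) ≠ 0 := by positivity
    rw [one_div, eq_inv_mul_iff_mul_eq₀ hf, H j]
    refine sum_congr rfl fun k _ => ?_
    simp only [hcdef]
    ring
  have step : ∀ j : ℕ, ((2 * j).factorial : ℝ) * α j = T j →
      (2 * j : ℝ) * (2 * j - 1) * T (j - 1) = ((2 * j).factorial : ℝ) * α ((j : ℤ) - 1) →
      ((2 * (j + 1)).factorial : ℝ) * α ((j + 1 : ℕ) : ℤ) = T (j + 1) := by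
    intro j hj hj'
    have h1 : (j : ℝ) + A ≠ 0 := by positivity
    have h2 : (j : ℝ) + A + 1 / 2 ≠ 0 := by positivity
    have hr := hrec j
    rw [haA] at hr
    rw [show 2 * (j + 1) = 2 * j + 1 + 1 by ring, Nat.factorial_succ, Nat.factorial_succ]
    push_cast
    refine mul_left_cancel₀ (mul_ne_zero h1 h2) ?_
    linear_combination ((2 * j).factorial : ℝ) / 4 * hr - hT j + hj' / 4
      + (X ^ 2 - A ^ 2 + (j + A + 1 / 2) * (j + A) + j * (j - 1 / 2)) * hj
  have pair : ∀ j : ℕ, ((2 * j).factorial : ℝ) * α j = T j ∧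
      ((2 * (j + 1)).factorial : ℝ) * α ((j + 1 : ℕ) : ℤ) = T (j + 1) := by
    intro j
    induction j with
    | zero =>
      have hz : ((2 * 0).factorial : ℝ) * α ((0 : ℕ) : ℤ) = T 0 := by simp [hTdef, hcdef, h0]
      exact ⟨hz, step 0 hz (by simp [hneg])⟩
    | succ j ih =>
      refine ⟨ih.2, step (j + 1) ih.2 ?_⟩
      rw [Nat.add_sub_cancel, ← ih.1, show (((j + 1 : ℕ) : ℤ) - 1) = (j : ℤ) by simp,
        show 2 * (j + 1) = 2 * j + 1 + 1 by ring, Nat.factorial_succ, Nat.factorial_succ]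
      push_cast
      ring
  exact fun j => (pair j).1
end
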